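/- arXiv:0807.2019 — 5 statements merged into one kernel-verified Lean document; each statement's English description precedes it below -/
import Mathlib

section
/- Let g be a finite dimensional simple Lie algebra over an algebraically closed field k of characteristic 0, σ₁,…,σₙ commuting finite-order automorphisms with g^σ ≠ 0, and h a Cartan subalgebra of the reductive Lie algebra g^σ. Then the Killing form of g is nondegenerate when restricted to h. -/
/-- The common fixed-point subalgebra of a family of Lie algebra automorphisms. -/
def fixedLieSubalgebra {k L : Type*} [CommRing k] [LieRing L] [LieAlgebra k L]
    {n : ℕ} (σ : Fin n → (L ≃ₗ[k] L))
    (hlie : ∀ i (x y : L), σ i ⁅x, y⁆ = ⁅σ i x, σ i y⁆) : LieSubalgebra k L where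
  carrier := {x | ∀ i, σ i x = x}
  add_mem' := fun {a b} ha hb i => by rw [map_add, ha i, hb i]
  zero_mem' := fun i => map_zero _
  smul_mem' := fun c {x} hx i => by rw [map_smul, hx i]
  lie_mem' := fun {x y} hx hy i => by rw [hlie i, hx i, hy i]

/-- Averaging: each `y` may be replaced by a vector fixed by all `σ i`, `i ∈ s`, without changing
the vanishing of `B x` for `x` fixed and `B` invariant. -/
lemma exists_fixed_avg {k L : Type*} [Field k] [CharZero k] [AddCommGroup L] [Module k L]
    {n : ℕ} (σ : Fin n → (L ≃ₗ[k] L))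
    (hcomm : ∀ i j (x : L), σ i (σ j x) = σ j (σ i x))
    (hfin : ∀ i, IsOfFinOrder (σ i)) (f : L →ₗ[k] k)
    (hf : ∀ i y, f (σ i y) = f y) (s : Finset (Fin n)) (y : L) (hy : f y ≠ 0) :
    ∃ z, (∀ i ∈ s, σ i z = z) ∧ f z ≠ 0 := by
  classical
  induction s using Finset.induction_on with
  | empty => exact ⟨y, by simp, hy⟩
  | insert a s _ ih =>
    obtain ⟨z, hz, hfz⟩ := ih
    obtain ⟨m, hm, hma⟩ := (isOfFinOrder_iff_pow_eq_one).1 (hfin a)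
    have hsucc : ∀ j : ℕ, (σ a ^ (j + 1)) z = σ a ((σ a ^ j) z) := fun j => by
      rw [pow_succ']; rfl
    refine ⟨∑ j ∈ Finset.range m, (σ a ^ j) z, ?_, ?_⟩
    · intro i hi
      rcases Finset.mem_insert.1 hi with rfl | hi
      · rw [map_sum]
        simp_rw [← hsucc]
        have h1 := Finset.sum_range_succ (fun j => (σ i ^ j) z) m
        have h2 := Finset.sum_range_succ' (fun j => (σ i ^ j) z) m
        rw [h1, hma] at h2
        simpa using h2.symm
      · rw [map_sum]
        refine Finset.sum_congr rfl fun j hj => ?_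
        clear hj
        induction j with
        | zero => simpa using hz i hi
        | succ j ihj => rw [hsucc, hcomm, ihj]
    · have hj : ∀ j : ℕ, f ((σ a ^ j) z) = f z := by
        intro j
        induction j with
        | zero => simp
        | succ j ihj => rw [hsucc, hf, ihj]
      rw [map_sum]
      simp only [hj, Finset.sum_const, Finset.card_range, nsmul_eq_mul]
      exact mul_ne_zero (by exact_mod_cast hm.ne') hfz

/-- if `g^σ ≠ 0` and `h` is a Cartan subalgebra of the reductive Lie algebra
`g^σ`, then the Killing form of `g` is nondegenerate on (the image in `g` of) `h`. -/
theorem killingForm_nondeg_on_cartan_of_fixed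
    (k L : Type*) [Field k] [IsAlgClosed k] [CharZero k]
    [LieRing L] [LieAlgebra k L] [FiniteDimensional k L] [LieAlgebra.IsSimple k L]
    {n : ℕ} (σ : Fin n → (L ≃ₗ[k] L))
    (hlie : ∀ i (x y : L), σ i ⁅x, y⁆ = ⁅σ i x, σ i y⁆)
    (hcomm : ∀ i j (x : L), σ i (σ j x) = σ j (σ i x))
    (hfin : ∀ i, IsOfFinOrder (σ i))
    (hne : fixedLieSubalgebra σ hlie ≠ ⊥)
    (h : LieSubalgebra k ↥(fixedLieSubalgebra σ hlie))
    (hcartan : h.IsCartanSubalgebra) :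
    ∀ x ∈ h.map (fixedLieSubalgebra σ hlie).incl,
      (∀ y ∈ h.map (fixedLieSubalgebra σ hlie).incl, killingForm k L x y = 0) → x = 0 := by
  classical
  rintro x ⟨x₀, hx₀, rfl⟩ hx
  by_contra hne0
  have := hcartan
  have hnd := LieAlgebra.IsKilling.killingForm_nondegenerate k L
  obtain ⟨y, hy⟩ : ∃ y, killingForm k L (x₀ : L) y ≠ 0 := by
    by_contra! hcon
    exact hne0 (hnd.1 _ hcon)
  have hinv : ∀ i y, killingForm k L (x₀ : L) (σ i y) = killingForm k L (x₀ : L) y := by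
    intro i y
    let e : L ≃ₗ⁅k⁆ L := { σ i with map_lie' := fun {a b} => hlie i a b }
    have h1 := LieAlgebra.killingForm_of_equiv_apply e (x₀ : L) y
    have h2 : e (x₀ : L) = x₀ := x₀.2 i
    rw [h2] at h1
    exact h1
  obtain ⟨z, hz, hfz⟩ := exists_fixed_avg σ hcomm hfin _ hinv Finset.univ y hy
  let z' : (fixedLieSubalgebra σ hlie) := ⟨z, fun i => hz i (Finset.mem_univ i)⟩
  have hc := LieModule.isCompl_genWeightSpace_zero_posFittingComp k h (fixedLieSubalgebra σ hlie)
  have hr : LieModule.genWeightSpace (fixedLieSubalgebra σ hlie) (0 : h → k) = h.toLieSubmodule :=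
    LieAlgebra.rootSpace_zero_eq k (fixedLieSubalgebra σ hlie) h
  have hz' : z' ∈ LieModule.genWeightSpace (fixedLieSubalgebra σ hlie) (0 : h → k) ⊔ LieModule.posFittingComp k h (fixedLieSubalgebra σ hlie) := by
    rw [hc.sup_eq_top]; trivial
  obtain ⟨a, ha, b, hb, hab⟩ := (LieSubmodule.mem_sup _ _ _).1 hz'
  have hx₀' : x₀ ∈ LieModule.genWeightSpace (fixedLieSubalgebra σ hlie) (0 : h → k) := by
    rw [hr]; exact hx₀
  rw [hr] at ha
  have h1 := LieModule.eq_zero_of_mem_genWeightSpace_mem_posFitting k h (fixedLieSubalgebra σ hlie)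
    (B := (killingForm k L).compl₁₂ (fixedLieSubalgebra σ hlie).toSubmodule.subtype (fixedLieSubalgebra σ hlie).toSubmodule.subtype)
    (fun u v w => LieModule.traceForm_apply_lie_apply' k L L (u : (fixedLieSubalgebra σ hlie)) (v : L) (w : L)) hx₀' hb
  have h2 : killingForm k L (x₀ : L) (a : L) = 0 := hx _ ⟨a, ha, rfl⟩
  apply hfz
  have h3 : z = (a : L) + (b : L) := (congrArg Subtype.val hab).symm
  rw [h3, map_add, h2, zero_add]
  exact h1
end

section
/- Let g be a finite dimensional simple Lie algebra over an algebraically closed field k of characteristic 0, σ₁,…,σₙ commuting finite-order automorphisms with g^σ ≠ 0, and h a Cartan subalgebra of g^σ. Then every element of h acts ad-diagonalizably on g, i.e. for each H ∈ h, ad_g(H) is a diagonalizable endomorphism of g. -/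
open LieAlgebra LieModule Module.End in
/-- Averaging: every element of `L` has the same Killing pairing with the fixed subalgebra as some
fixed element. -/
lemma exists_fixed_killingForm_eq
    {k L : Type*} [Field k] [CharZero k]
    [LieRing L] [LieAlgebra k L] [FiniteDimensional k L]
    {n : ℕ} (σ : Fin n → (L ≃ₗ[k] L))
    (hlie : ∀ i (x y : L), σ i ⁅x, y⁆ = ⁅σ i x, σ i y⁆)
    (hcomm : ∀ i j (x : L), σ i (σ j x) = σ j (σ i x))
    (hfin : ∀ i, IsOfFinOrder (σ i)) (y : L) :
    ∃ z ∈ fixedLieSubalgebra σ hlie, ∀ x ∈ fixedLieSubalgebra σ hlie,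
      killingForm k L x z = killingForm k L x y := by
  have hinv (i : Fin n) (x z : L) : killingForm k L (σ i x) (σ i z) = killingForm k L x z := by
    let e : L ≃ₗ⁅k⁆ L := { σ i with map_lie' := fun {a b} => hlie i a b }
    exact killingForm_of_equiv_apply e x z
  suffices ∀ s : Finset (Fin n), ∃ z, (∀ i ∈ s, σ i z = z) ∧
      ∀ x ∈ fixedLieSubalgebra σ hlie, killingForm k L x z = killingForm k L x y by
    obtain ⟨z, hz, hz'⟩ := this Finset.univ
    exact ⟨z, fun i => hz i (Finset.mem_univ i), hz'⟩
  intro s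
  induction s using Finset.induction_on with
  | empty => exact ⟨y, by simp, fun _ _ => rfl⟩
  | insert i s his ih =>
    obtain ⟨z, hz, hz'⟩ := ih
    set m := orderOf (σ i)
    have hm : 0 < m := (hfin i).orderOf_pos
    have hm' : (m : k) ≠ 0 := by exact_mod_cast hm.ne'
    refine ⟨(m : k)⁻¹ • ∑ j ∈ Finset.range m, (σ i ^ j) z, ?_, ?_⟩
    · intro l hl
      rw [map_smul, map_sum]
      congr 1
      rw [Finset.mem_insert] at hl
      rcases hl with rfl | hl
      · have h1 : ∀ j, σ l ((σ l ^ j) z) = (σ l ^ (j + 1)) z := fun j => by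
          rw [pow_succ']; rfl
        simp_rw [h1]
        have h2 := Finset.sum_range_succ (fun j => (σ l ^ j) z) m
        rw [Finset.sum_range_succ'] at h2
        have h3 : σ l ^ m = 1 := pow_orderOf_eq_one _
        simpa [h3] using h2
      · refine Finset.sum_congr rfl fun j _ => ?_
        have hc : Commute (σ l) (σ i) := LinearEquiv.ext fun x => hcomm l i x
        have := LinearEquiv.congr_fun ((hc.pow_right j).eq) z
        change σ l ((σ i ^ j) z) = (σ i ^ j) (σ l z) at this
        rw [this, hz l hl]
    · intro x hx
      have h1 : ∀ j, killingForm k L x ((σ i ^ j) z) = killingForm k L x y := by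
        intro j
        induction j with
        | zero => simpa using hz' x hx
        | succ j ihj =>
          rw [← ihj, pow_succ']
          change killingForm k L x (σ i ((σ i ^ j) z)) = _
          conv_lhs => rw [← hx i]
          exact hinv _ _ _
      rw [map_smul, map_sum]
      simp [h1, hm']

open LieAlgebra LieModule Module.End in
lemma isSemisimple_ad_of_mem_cartan_of_fixed
    {k L : Type*} [Field k] [IsAlgClosed k] [CharZero k]
    [LieRing L] [LieAlgebra k L] [FiniteDimensional k L] [LieAlgebra.IsSimple k L]
    {n : ℕ} (σ : Fin n → (L ≃ₗ[k] L))
    (hlie : ∀ i (x y : L), σ i ⁅x, y⁆ = ⁅σ i x, σ i y⁆)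
    (G : LieSubalgebra k L) (hmem : ∀ x, x ∈ G ↔ ∀ i, σ i x = x)
    (havg : ∀ y : L, ∃ z ∈ G, ∀ x ∈ G, killingForm k L x z = killingForm k L x y)
    (h : LieSubalgebra k G) [hcartan : h.IsCartanSubalgebra] :
    ∀ x ∈ h.map G.incl, (ad k L x).IsSemisimple := by
  have : IsKilling k L := inferInstance
  -- The Killing form of `L` restricted to `G` is non-degenerate.
  have hnd : LinearMap.ker (traceForm k G L) = ⊥ := by
    rw [LinearMap.ker_eq_bot']
    intro x hx
    have hx' : (x : L) ∈ LinearMap.ker (killingForm k L) := by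
      rw [LinearMap.mem_ker]
      ext y
      obtain ⟨z, hz, hzy⟩ := havg y
      rw [← hzy x x.2]
      exact LinearMap.congr_fun hx ⟨z, hz⟩
    rw [IsKilling.ker_killingForm_eq_bot] at hx'
    exact Subtype.ext (by simpa using hx')
  have hnd' : LinearMap.ker (traceForm k h L) = ⊥ := by
    have hc : Codisjoint (rootSpace h 0) (posFittingComp k h G) :=
      (isCompl_genWeightSpace_zero_posFittingComp k h G).codisjoint
    replace hc : Codisjoint (h : Submodule k G) (posFittingComp k h G : Submodule k G) := by
      rwa [codisjoint_iff, ← LieSubmodule.toSubmodule_inj, LieSubmodule.sup_toSubmodule,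
        LieSubmodule.top_toSubmodule, rootSpace_zero_eq k G h, LieSubalgebra.coe_toLieSubmodule,
        ← codisjoint_iff] at hc
    have horth : ∀ m₀ ∈ h, ∀ m₁ ∈ posFittingComp k h G, traceForm k G L m₀ m₁ = 0 := by
      intro m₀ h₀ m₁ h₁
      exact eq_zero_of_mem_genWeightSpace_mem_posFitting k h G
        (B := traceForm k G L)
        (fun x y z ↦ traceForm_apply_lie_apply' k G L x y z)
        (le_zeroRootSubalgebra k G h h₀) h₁
    change LinearMap.ker ((traceForm k G L).restrict h) = ⊥
    simp [LinearMap.BilinForm.ker_restrict_eq_of_codisjoint hc horth, hnd]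
  have hab : IsLieAbelian h := isLieAbelian_of_ker_traceForm_eq_bot k h L hnd'
  have hnil (x : h) (hx : _root_.IsNilpotent (ad k L ((x : G) : L))) : x = 0 := by
    have : x ∈ LinearMap.ker (traceForm k h L) := by
      rw [LinearMap.mem_ker]
      ext y
      have comm : Commute (toEnd k h L x) (toEnd k h L y) := by
        refine LinearMap.ext fun m => ?_
        change ⁅x, ⁅y, m⁆⁆ = ⁅y, ⁅x, m⁆⁆
        rw [leibniz_lie, trivial_lie_zero h h x y, zero_lie, zero_add]
      rw [traceForm_apply_apply, ← Module.End.mul_eq_comp, LinearMap.zero_apply]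
      exact (LinearMap.isNilpotent_trace_of_isNilpotent
        (comm.isNilpotent_mul_right hx)).eq_zero
    simpa [hnd'] using this
  set H := h.map G.incl with hH
  have habH : IsLieAbelian H := by
    refine ⟨?_⟩
    rintro ⟨_, a, ha, rfl⟩ ⟨_, b, hb, rfl⟩
    have := hab.trivial ⟨a, ha⟩ ⟨b, hb⟩
    apply Subtype.ext
    have h2 := congrArg (fun z : h => ((z : G) : L)) this
    exact h2
  intro x hx
  obtain ⟨N, -, S, hS₀', hN, hS, hSN⟩ := (ad k L x).exists_isNilpotent_isSemisimple
  have hS₀ : Commute (ad k L x) S := Algebra.commute_of_mem_adjoin_self hS₀'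
  set x' : H := ⟨x, hx⟩
  rw [eq_sub_of_add_eq hSN.symm] at hN
  have aux {α : H → k} {y : L} (hy : y ∈ rootSpace H α) : S y = α x' • y := by
    replace hy : y ∈ (ad k L x).maxGenEigenspace (α x') :=
      (genWeightSpace_le_genWeightSpaceOf L x' α) hy
    rw [maxGenEigenspace_eq] at hy
    rw [apply_eq_of_mem_of_comm_of_isFinitelySemisimple_of_isNil hy hS₀ hS.isFinitelySemisimple hN]
  have h_der (y z : L) (α β : H → k) (hy : y ∈ rootSpace H α) (hz : z ∈ rootSpace H β) :
      S ⁅y, z⁆ = ⁅S y, z⁆ + ⁅y, S z⁆ := by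
    have hyz : ⁅y, z⁆ ∈ rootSpace H (α + β) :=
      mapsTo_toEnd_genWeightSpace_add_of_mem_rootSpace k L H L α β hy hz
    rw [aux hy, aux hz, aux hyz, smul_lie, lie_smul, ← add_smul, ← Pi.add_apply]
  replace h_der (y z : L) : S ⁅y, z⁆ = ⁅S y, z⁆ + ⁅y, S z⁆ := by
    have hy : y ∈ ⨆ α : H → k, rootSpace H α := by simp [iSup_genWeightSpace_eq_top]
    have hz : z ∈ ⨆ α : H → k, rootSpace H α := by simp [iSup_genWeightSpace_eq_top]
    induction hy using LieSubmodule.iSup_induction' with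
    | mem α y hy =>
      induction hz using LieSubmodule.iSup_induction' with
      | mem β z hz => exact h_der y z α β hy hz
      | zero => simp
      | add _ _ _ _ h h' => simp only [lie_add, map_add, h, h']; abel
    | zero => simp
    | add _ _ _ _ h h' => simp only [add_lie, map_add, h, h']; abel
  replace h_der : ∀ y z : L, S ⁅y, z⁆ = ⁅y, S z⁆ - ⁅z, S y⁆ := by
    simp_rw [← lie_skew (S _) _, add_comm, ← sub_eq_add_neg] at h_der; assumption
  let S' : LieDerivation k L L := ⟨S, h_der⟩
  obtain ⟨y, hy⟩ := LieDerivation.IsKilling.exists_eq_ad S'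
  have hSy : S = ad k L y := by rw [← LieDerivation.coe_ad_apply_eq_ad_apply y, hy]
  have hy' (z : L) (hz : z ∈ H) : ⁅y, z⁆ = 0 := by
    have hz0 : z ∈ rootSpace H (0 : H → k) := le_zeroRootSubalgebra k L H hz
    have := aux hz0
    rw [hSy] at this
    simpa using this
  -- `y` is fixed by all `σ i`.
  have hxG : x ∈ G := by
    obtain ⟨a, ha, rfl⟩ := hx
    exact a.2
  have hyG : y ∈ G := by
    refine (hmem y).mpr fun i => ?_
    have hc : Commute (σ i : Module.End k L) (ad k L x) := by
      refine LinearMap.ext fun z => ?_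
      change σ i ⁅x, z⁆ = ⁅x, σ i z⁆
      rw [hlie i, (hmem x).mp hxG i]
    have hcS : Commute (σ i : Module.End k L) S :=
      Algebra.commute_of_mem_adjoin_singleton_of_commute hS₀' hc
    have hz : ∀ z : L, ⁅σ i y - y, z⁆ = 0 := by
      intro z
      have := LinearMap.congr_fun hcS.eq ((σ i).symm z)
      rw [hSy] at this
      change σ i ⁅y, (σ i).symm z⁆ = ⁅y, σ i ((σ i).symm z)⁆ at this
      rw [hlie i, LinearEquiv.apply_symm_apply] at this
      rw [sub_lie, this, sub_self]
    have : σ i y - y ∈ LieAlgebra.center k L := by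
      rw [LieModule.mem_maxTrivSubmodule]
      intro z
      rw [← lie_skew, hz, neg_zero]
    rw [LieAlgebra.center_eq_bot] at this
    exact sub_eq_zero.mp (by simpa using this)
  have hyh : (⟨y, hyG⟩ : G) ∈ h := by
    suffices (⟨y, hyG⟩ : G) ∈ h.normalizer by
      rwa [LieSubalgebra.IsCartanSubalgebra.self_normalizing] at this
    refine (h.mem_normalizer_iff _).mpr fun z hz ↦ ?_
    have : ⁅(⟨y, hyG⟩ : G), z⁆ = 0 := Subtype.ext (hy' z ⟨z, hz, rfl⟩)
    rw [this]
    exact h.zero_mem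
  have hxh : (⟨x, hxG⟩ : G) ∈ h := by
    obtain ⟨a, ha, rfl⟩ := hx
    exact ha
  have hxy : x = y := by
    have := hnil (⟨⟨x, hxG⟩, hxh⟩ - ⟨⟨y, hyG⟩, hyh⟩) (by
      change _root_.IsNilpotent (ad k L (x - y))
      rwa [map_sub, ← hSy])
    have h2 := congrArg (fun z : h => ((z : G) : L)) this
    exact sub_eq_zero.mp h2
  rwa [hxy, ← hSy]

theorem cartan_of_fixed_ad_diagonalizable
    (k L : Type*) [Field k] [IsAlgClosed k] [CharZero k]
    [LieRing L] [LieAlgebra k L] [FiniteDimensional k L] [LieAlgebra.IsSimple k L]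
    {n : ℕ} (σ : Fin n → (L ≃ₗ[k] L))
    (hlie : ∀ i (x y : L), σ i ⁅x, y⁆ = ⁅σ i x, σ i y⁆)
    (hcomm : ∀ i j (x : L), σ i (σ j x) = σ j (σ i x))
    (hfin : ∀ i, IsOfFinOrder (σ i))
    (hne : fixedLieSubalgebra σ hlie ≠ ⊥)
    (h : LieSubalgebra k ↥(fixedLieSubalgebra σ hlie))
    (hcartan : h.IsCartanSubalgebra) :
    ∀ H ∈ h.map (fixedLieSubalgebra σ hlie).incl,
      ⨆ μ : k, Module.End.eigenspace (LieAlgebra.ad k L H) μ = ⊤ := by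
  intro H hH
  exact (isSemisimple_ad_of_mem_cartan_of_fixed σ hlie (fixedLieSubalgebra σ hlie)
    (fun _ => Iff.rfl) (exists_fixed_killingForm_eq σ hlie hcomm hfin) h H
    hH).iSup_eigenspace_eq_top
end

section
/- Let g be a finite dimensional simple Lie algebra over an algebraically closed field k of characteristic 0, σ = (σ₁,…,σₙ) commuting finite-order automorphisms with g^σ ≠ 0, h a Cartan subalgebra of g^σ. Then Δ = supp_{h*}(g) \ {0} is an irreducible (possibly non-reduced) finite root system in h*. -/
/-- The root space of `L` relative to a subalgebra `h`, attached to a functional `α` on `h`. -/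
def rootSpaceOf {k L : Type*} [Field k] [LieRing L] [LieAlgebra k L]
    (h : LieSubalgebra k L) (α : Module.Dual k h) : Submodule k L where
  carrier := {x | ∀ H : h, ⁅(H : L), x⁆ = α H • x}
  add_mem' := fun {a b} ha hb H => by rw [lie_add, ha H, hb H, smul_add]
  zero_mem' := fun H => by rw [lie_zero, smul_zero]
  smul_mem' := fun c {x} hx H => by rw [lie_smul, hx H, smul_comm]


section

open LieAlgebra LieModule Module

/-- Jordan decomposition inside a Killing Lie algebra. -/
lemma aux_jordan {k L : Type*} [Field k] [IsAlgClosed k] [CharZero k]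
    [LieRing L] [LieAlgebra k L] [FiniteDimensional k L] [LieAlgebra.IsKilling k L] (x : L) :
    ∃ s : L, ad k L s ∈ Algebra.adjoin k {ad k L x} ∧ (ad k L s).IsSemisimple ∧
      IsNilpotent (ad k L (x - s)) := by
  obtain ⟨N, -, S, hS₁, hN, hS, hSN⟩ := (ad k L x).exists_isNilpotent_isSemisimple
  have hS₀ : Commute (ad k L x) S := Algebra.commute_of_mem_adjoin_self hS₁
  rw [eq_sub_of_add_eq hSN.symm] at hN
  have aux {a : k} {y : L} (hy : y ∈ (ad k L x).maxGenEigenspace a) : S y = a • y := by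
    rw [End.maxGenEigenspace_eq] at hy
    rw [End.apply_eq_of_mem_of_comm_of_isFinitelySemisimple_of_isNil hy hS₀
      hS.isFinitelySemisimple hN]
  have htop : ⨆ a : k, (ad k L x).maxGenEigenspace a = ⊤ :=
    End.iSup_maxGenEigenspace_eq_top _
  have h_der (y z : L) : S ⁅y, z⁆ = ⁅S y, z⁆ + ⁅y, S z⁆ := by
    have hy : y ∈ ⨆ a : k, (ad k L x).maxGenEigenspace a := by simp [htop]
    have hz : z ∈ ⨆ a : k, (ad k L x).maxGenEigenspace a := by simp [htop]
    induction hy using Submodule.iSup_induction' with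
    | mem a y hy =>
      induction hz using Submodule.iSup_induction' with
      | mem b z hz =>
        have hyz : ⁅y, z⁆ ∈ (ad k L x).maxGenEigenspace (a + b) :=
          lie_mem_maxGenEigenspace_toEnd (L := L) (M := L) hy hz
        rw [aux hy, aux hz, aux hyz, smul_lie, lie_smul, ← add_smul]
      | zero => simp
      | add _ _ _ _ h h' => simp only [lie_add, map_add, h, h']; abel
    | zero => simp
    | add _ _ _ _ h h' => simp only [add_lie, map_add, h, h']; abel
  replace h_der : ∀ y z : L, S ⁅y, z⁆ = ⁅y, S z⁆ - ⁅z, S y⁆ := by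
    simp_rw [← lie_skew (S _) _, add_comm, ← sub_eq_add_neg] at h_der; assumption
  let S' : LieDerivation k L L := ⟨S, h_der⟩
  obtain ⟨y, hy⟩ := LieDerivation.IsKilling.exists_eq_ad S'
  replace hy : S = ad k L y := by rw [← LieDerivation.coe_ad_apply_eq_ad_apply y, hy]
  refine ⟨y, hy ▸ hS₁, hy ▸ hS, ?_⟩
  rwa [map_sub, ← hy]

/-- Averaging: for commuting finite-order operators preserving a subspace `W` and a functional. -/
lemma aux_average {k L : Type*} [Field k] [CharZero k] [AddCommGroup L] [Module k L]
    {n : ℕ} (T : Fin n → End k L) (hc : ∀ i j (x : L), T i (T j x) = T j (T i x))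
    (m : Fin n → ℕ) (hm : ∀ i, m i ≠ 0) (hT : ∀ i, T i ^ m i = 1)
    (W : Submodule k L) (hW : ∀ i, ∀ x ∈ W, T i x ∈ W) (φ : Dual k L)
    (hφ : ∀ i x, φ (T i x) = φ x) (y : L) (hy : y ∈ W) :
    ∃ y' ∈ W, (∀ i, T i y' = y') ∧ φ y' = φ y := by
  classical
  suffices ∀ s : Finset (Fin n), ∃ y' ∈ W, (∀ i ∈ s, T i y' = y') ∧ φ y' = φ y by
    obtain ⟨y', h1, h2, h3⟩ := this Finset.univ
    exact ⟨y', h1, fun i => h2 i (Finset.mem_univ i), h3⟩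
  intro s
  induction s using Finset.induction_on with
  | empty => exact ⟨y, hy, by simp, rfl⟩
  | insert a s ha ih =>
    obtain ⟨z, hz, hz2, hz3⟩ := ih
    have hWp : ∀ j : ℕ, (T a ^ j) z ∈ W := by
      intro j
      induction j with
      | zero => simpa using hz
      | succ j ih => rw [pow_succ', End.mul_apply]; exact hW _ _ ih
    have hφp : ∀ j : ℕ, φ ((T a ^ j) z) = φ z := by
      intro j
      induction j with
      | zero => simp
      | succ j ih => rw [pow_succ', End.mul_apply, hφ, ih]
    have hfp : ∀ i ∈ s, ∀ j : ℕ, T i ((T a ^ j) z) = (T a ^ j) z := by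
      intro i hi j
      induction j with
      | zero => simpa using hz2 i hi
      | succ j ih => rw [pow_succ', End.mul_apply, hc, ih]
    refine ⟨(m a : k)⁻¹ • ∑ j ∈ Finset.range (m a), (T a ^ j) z, ?_, ?_, ?_⟩
    · exact W.smul_mem _ (W.sum_mem fun j _ => hWp j)
    · intro i hi
      rw [Finset.mem_insert] at hi
      rw [map_smul, map_sum]
      congr 1
      rcases hi with rfl | hi
      · have h1 : ∀ j : ℕ, T i ((T i ^ j) z) = (T i ^ (j + 1)) z := fun j => by
          rw [pow_succ', End.mul_apply]
        simp_rw [h1]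
        have h2 := Finset.sum_range_succ (fun j => (T i ^ j) z) (m i)
        rw [Finset.sum_range_succ', hT] at h2
        simpa using h2
      · exact Finset.sum_congr rfl fun j _ => hfp i hi j
    · rw [map_smul, map_sum]
      simp_rw [hφp]
      have : (m a : k) ≠ 0 := by exact_mod_cast hm a
      simp [hz3, this]

lemma aux_killing {k L : Type*} [Field k] [LieRing L] [LieAlgebra k L]
    (τ : L ≃ₗ[k] L) (hτ : ∀ x y : L, τ ⁅x, y⁆ = ⁅τ x, τ y⁆) (x y : L) :
    killingForm k L (τ x) (τ y) = killingForm k L x y := by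
  let e : L ≃ₗ⁅k⁆ L := { τ with map_lie' := fun {x y} => hτ x y }
  exact LieAlgebra.killingForm_of_equiv_apply e x y

section
variable {k L : Type*} [Field k] [IsAlgClosed k] [CharZero k]
    [LieRing L] [LieAlgebra k L] [FiniteDimensional k L]

set_option linter.unusedSectionVars false

lemma aux_ad_zero [LieAlgebra.IsKilling k L] (x : L) (hx : ad k L x = 0) : x = 0 := by
  have h1 : x ∈ LieAlgebra.center k L := by
    rw [LieModule.mem_maxTrivSubmodule]
    intro y
    rw [← lie_skew, ← ad_apply (R := k), hx]; simp
  rw [LieAlgebra.center_eq_bot] at h1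
  simpa using h1

lemma aux_fixed_nondeg [LieAlgebra.IsKilling k L]
    {n : ℕ} (σ : Fin n → (L ≃ₗ[k] L))
    (hlie : ∀ i (x y : L), σ i ⁅x, y⁆ = ⁅σ i x, σ i y⁆)
    (hcomm : ∀ i j (x : L), σ i (σ j x) = σ j (σ i x))
    (hfin : ∀ i, IsOfFinOrder (σ i)) (x : L) (hx : x ∈ fixedLieSubalgebra σ hlie)
    (h0 : ∀ y ∈ fixedLieSubalgebra σ hlie, killingForm k L x y = 0) : x = 0 := by
  choose m hm0 hm using fun i => isOfFinOrder_iff_pow_eq_one.mp (hfin i)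
  have hx' : ∀ i, σ i x = x := hx
  have key : ∀ y, killingForm k L x y = 0 := by
    intro y
    obtain ⟨y', -, h1, h2⟩ := aux_average (fun i => (σ i : L →ₗ[k] L)) hcomm m
      (fun i => (hm0 i).ne') (fun i => by
        have := congrArg (fun e : L ≃ₗ[k] L => (e : L →ₗ[k] L)) (hm i)
        ext z
        have h3 := LinearMap.congr_fun this z
        have h4 : ∀ j : ℕ, ((σ i : L →ₗ[k] L) ^ j) z = (σ i ^ j) z := by
          intro j
          induction j with
          | zero => rfl
          | succ j ih => rw [pow_succ', pow_succ', End.mul_apply, ih]; rfl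
        rw [h4]; exact h3)
      ⊤ (by simp) (killingForm k L x) (fun i y => by
        have := aux_killing (σ i) (hlie i) x y
        rw [hx' i] at this
        exact this) y trivial
    rw [← h2]
    exact h0 y' h1
  have := LieAlgebra.IsKilling.killingForm_nondegenerate k L
  exact this.1 x key

lemma aux_fixed_jordan [LieAlgebra.IsKilling k L]
    {n : ℕ} (σ : Fin n → (L ≃ₗ[k] L))
    (hlie : ∀ i (x y : L), σ i ⁅x, y⁆ = ⁅σ i x, σ i y⁆)
    (x s : L) (hx : x ∈ fixedLieSubalgebra σ hlie)
    (hs : ad k L s ∈ Algebra.adjoin k {ad k L x}) : s ∈ fixedLieSubalgebra σ hlie := by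
  have hx' : ∀ i, σ i x = x := hx
  intro i
  have h1 : Commute (σ i : End k L) (ad k L x) := by
    ext z
    have := hlie i x z
    rw [hx'] at this
    simpa using this
  have h2 : Commute (σ i : End k L) (ad k L s) :=
    Algebra.commute_of_mem_adjoin_singleton_of_commute hs h1
  have h3 : ad k L (σ i s - s) = 0 := by
    ext z
    have := LinearMap.congr_fun h2 ((σ i).symm z)
    simp only [End.mul_apply, ad_apply] at this
    have h4 := hlie i s ((σ i).symm z)
    simp at this h4 ⊢
    rw [← h4, this, sub_self]
  exact sub_eq_zero.mp (aux_ad_zero _ h3)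

variable (G : LieSubalgebra k L) (h : LieSubalgebra k G) [hcartan : h.IsCartanSubalgebra]

lemma aux_h_nondeg (hG : ∀ x ∈ G, (∀ y ∈ G, killingForm k L x y = 0) → x = 0)
    (x : G) (hx : x ∈ h) (h0 : ∀ y ∈ h, killingForm k L x y = 0) : x = 0 := by
  refine Subtype.ext (hG x x.2 fun y hy => ?_)
  have hc : Codisjoint (rootSpace h 0) (LieModule.posFittingComp k h G) :=
    (LieModule.isCompl_genWeightSpace_zero_posFittingComp k h G).codisjoint
  have hy' : (⟨y, hy⟩ : G) ∈ (rootSpace h 0 ⊔ LieModule.posFittingComp k h G) := by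
    rw [codisjoint_iff.mp hc]; trivial
  obtain ⟨a, ha, b, hb, hab⟩ := (LieSubmodule.mem_sup _ _ _).mp hy'
  have hx0 : x ∈ rootSpace h (0 : h → k) := by
    rw [rootSpace_zero_eq]; exact hx
  rw [rootSpace_zero_eq] at ha
  have e1 : killingForm k L x a = 0 := h0 a ha
  have e2 : killingForm k L x b = 0 := by
    refine eq_zero_of_mem_genWeightSpace_mem_posFitting k h G
      (B := (killingForm k L).restrict G.toSubmodule) ?_ hx0 hb
    intro z m n
    have := LieModule.traceForm_apply_lie_apply' k L L (z : L) (m : L) (n : L)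
    exact this
  have : y = (a : L) + (b : L) := by
    have := congrArg Subtype.val hab
    simpa using this.symm
  rw [this, map_add, e1, e2, add_zero]

lemma aux_h_semisimple [LieAlgebra.IsKilling k L]
    (hG : ∀ x ∈ G, (∀ y ∈ G, killingForm k L x y = 0) → x = 0)
    (hJ : ∀ x s : L, x ∈ G → ad k L s ∈ Algebra.adjoin k {ad k L x} → s ∈ G)
    (x : G) (hx : x ∈ h) : (ad k L (x : L)).IsSemisimple := by
  obtain ⟨s, hs, hss, hnil⟩ := aux_jordan (k := k) (x : L)
  have hsG := hJ x s x.2 hs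
  have hsh : (⟨s, hsG⟩ : G) ∈ h := by
    suffices (⟨s, hsG⟩ : G) ∈ h.normalizer by
      rwa [LieSubalgebra.IsCartanSubalgebra.self_normalizing] at this
    rw [LieSubalgebra.mem_normalizer_iff]
    intro y hy
    let p : Submodule k L := (h.map G.incl).toSubmodule
    have hp : ∀ f ∈ Algebra.adjoin k {ad k L (x : L)}, ∀ z ∈ p, f z ∈ p := by
      intro f hf
      induction hf using Algebra.adjoin_induction with
      | mem f hf =>
        rw [Set.mem_singleton_iff] at hf
        subst hf
        rintro z ⟨w, hw, rfl⟩
        exact ⟨⁅x, w⁆, h.lie_mem hx hw, rfl⟩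
      | algebraMap r => intro z hz; exact p.smul_mem r hz
      | add f g _ _ hf hg => intro z hz; exact p.add_mem (hf z hz) (hg z hz)
      | mul f g _ _ hf hg => intro z hz; exact hf _ (hg z hz)
    obtain ⟨w, hw, hw2⟩ := hp _ hs (y : L) ⟨y, hy, rfl⟩
    have : ⁅(⟨s, hsG⟩ : G), y⁆ = w := Subtype.ext hw2.symm
    rw [this]; exact hw
  have hz : x - ⟨s, hsG⟩ = 0 := by
    refine aux_h_nondeg G h hG _ (h.sub_mem hx hsh) fun y hy => ?_
    let d : h := ⟨x - ⟨s, hsG⟩, h.sub_mem hx hsh⟩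
    have e : killingForm k L ((x - ⟨s, hsG⟩ : G) : L) (y : L) =
      traceForm k h L d ⟨y, hy⟩ := rfl
    rw [e, traceForm_eq_sum_finrank_nsmul_mul]
    refine Finset.sum_eq_zero fun χ _ => ?_
    have hχ : χ d = 0 := by
      have hnil' : IsNilpotent (toEnd k h L d) := hnil
      have hb : genWeightSpace L χ ≠ ⊥ := χ.genWeightSpace_ne_bot'
      obtain ⟨v, hv, hv0⟩ := Submodule.exists_mem_ne_zero_of_ne_bot
        (fun e => hb ((LieSubmodule.toSubmodule_eq_bot _).mp e))
      have h1 : v ∈ (toEnd k h L d).maxGenEigenspace (χ d) :=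
        (genWeightSpace_le_genWeightSpaceOf L d χ) hv
      have h2 : v ∈ (toEnd k h L d).maxGenEigenspace 0 := by
        rw [End.mem_maxGenEigenspace]
        obtain ⟨N, hN⟩ := hnil'
        exact ⟨N, by simp [hN]⟩
      by_contra hne
      have := (End.disjoint_genEigenspace (toEnd k h L d) hne ⊤ ⊤).le_bot ⟨h1, h2⟩
      exact hv0 this
    simp [hχ]
  have hxs : (x : L) = s := congrArg Subtype.val (sub_eq_zero.mp hz)
  rw [hxs]; exact hss

lemma aux_h_abelian [LieAlgebra.IsKilling k L]
    (hss : ∀ x ∈ h, (ad k L (x : L)).IsSemisimple) (x y : G) (hx : x ∈ h) (hy : y ∈ h) :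
    ⁅(x : L), (y : L)⁆ = 0 := by
  have hx0 : y ∈ rootSpace h (0 : h → k) := by
    rw [rootSpace_zero_eq]; exact hy
  rw [mem_genWeightSpace] at hx0
  obtain ⟨N, hN⟩ := hx0 ⟨x, hx⟩
  have h1 : (y : L) ∈ (ad k L (x : L)).maxGenEigenspace 0 := by
    rw [End.mem_maxGenEigenspace]
    refine ⟨N, ?_⟩
    have : ∀ j : ℕ, ((ad k L (x : L)) ^ j) (y : L) = (((toEnd k h G ⟨x, hx⟩) ^ j) y : G) := by
      intro j
      induction j with
      | zero => rfl
      | succ j ih => rw [pow_succ', pow_succ', End.mul_apply, ih]; rfl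
    simp only [Pi.zero_apply, zero_smul, sub_zero] at hN ⊢
    rw [this, hN]; rfl
  rw [(hss x hx).isFinitelySemisimple.maxGenEigenspace_eq_eigenspace, End.mem_eigenspace_iff] at h1
  simpa using h1

end

section
set_option linter.unusedSectionVars false
variable {k L : Type*} [Field k] [IsAlgClosed k] [CharZero k]
    [LieRing L] [LieAlgebra k L] [FiniteDimensional k L]

lemma aux_diag (h' : LieSubalgebra k L) (hab : ∀ x ∈ h', ∀ y ∈ h', ⁅x, y⁆ = 0)
    (hss : ∀ x ∈ h', (ad k L x).IsSemisimple) :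
    ⨆ α : Dual k h', rootSpaceOf h' α = ⊤ := by
  have : IsLieAbelian h' := ⟨fun x y => Subtype.ext (hab x x.2 y y.2)⟩
  have h1 := iSup_genWeightSpace_eq_top' k h' L
  rw [← LieSubmodule.iSup_toSubmodule_eq_top] at h1
  rw [eq_top_iff, ← h1]
  refine iSup_le fun χ => le_trans ?_ (le_iSup _ (Weight.toLinear k h' L χ))
  intro v hv H
  have h2 : v ∈ (ad k L (H : L)).maxGenEigenspace (χ H) :=
    (genWeightSpace_le_genWeightSpaceOf L H χ) hv
  rw [(hss H H.2).isFinitelySemisimple.maxGenEigenspace_eq_eigenspace,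
    End.mem_eigenspace_iff] at h2
  simpa using h2

lemma aux_finite (h' : LieSubalgebra k L) (hab : ∀ x ∈ h', ∀ y ∈ h', ⁅x, y⁆ = 0) :
    {α : Dual k h' | α ≠ 0 ∧ rootSpaceOf h' α ≠ ⊥}.Finite := by
  have : IsLieAbelian h' := ⟨fun x y => Subtype.ext (hab x x.2 y y.2)⟩
  have h1 := finite_genWeightSpace_ne_bot k h' L
  refine Set.Finite.of_finite_image (f := fun α : Dual k h' => (α : h' → k)) (h1.subset ?_)
    (fun a _ b _ hab => DFunLike.coe_injective hab)
  rintro _ ⟨α, ⟨-, hα⟩, rfl⟩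
  obtain ⟨v, hv, hv0⟩ := Submodule.exists_mem_ne_zero_of_ne_bot hα
  intro hbot
  apply hv0
  have : v ∈ genWeightSpace L (α : h' → k) := by
    rw [mem_genWeightSpace]
    intro H
    refine ⟨1, ?_⟩
    have h3 : ⁅(H : L), v⁆ = α H • v := hv H
    have h4 : toEnd k h' L H v = ⁅(H : L), v⁆ := rfl
    simp [h4, h3]
  change genWeightSpace L (α : h' → k) = ⊥ at hbot
  rw [hbot] at this
  simpa using this

/-- Simultaneous eigenvectors in an invariant subspace. -/
lemma aux_eigen {n : ℕ} (T : Fin n → End k L) (hc : ∀ i j (x : L), T i (T j x) = T j (T i x))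
    (W : Submodule k L) (hW : ∀ i, ∀ x ∈ W, T i x ∈ W) (hW0 : W ≠ ⊥) :
    ∃ x ∈ W, x ≠ 0 ∧ ∀ i, ∃ c : k, T i x = c • x := by
  classical
  suffices ∀ s : Finset (Fin n), ∃ V ≤ W, V ≠ ⊥ ∧ (∀ i, ∀ x ∈ V, T i x ∈ V) ∧
      ∀ i ∈ s, ∃ c : k, ∀ x ∈ V, T i x = c • x by
    obtain ⟨V, h1, h2, -, h3⟩ := this Finset.univ
    obtain ⟨v, hv, hv0⟩ := Submodule.exists_mem_ne_zero_of_ne_bot h2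
    refine ⟨v, h1 hv, hv0, fun i => ?_⟩
    obtain ⟨c, hc⟩ := h3 i (Finset.mem_univ i)
    exact ⟨c, hc v hv⟩
  intro s
  induction s using Finset.induction_on with
  | empty => exact ⟨W, le_rfl, hW0, hW, by simp⟩
  | insert a s ha ih =>
    obtain ⟨V, h1, h2, h3, h4⟩ := ih
    have : Nontrivial V := Submodule.nontrivial_iff_ne_bot.mpr h2
    obtain ⟨c, hcc⟩ := End.exists_eigenvalue ((T a).restrict (h3 a))
    obtain ⟨v, hv⟩ := hcc.exists_hasEigenvector
    have hv1 := hv.apply_eq_smul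
    have hv2 := hv.2
    refine ⟨V ⊓ (T a).eigenspace c, inf_le_left.trans h1, ?_, ?_, ?_⟩
    · intro hb
      have : (v : L) ∈ V ⊓ (T a).eigenspace c :=
        ⟨v.2, End.mem_eigenspace_iff.mpr (congrArg Subtype.val hv1)⟩
      rw [hb] at this
      exact hv2 (Subtype.ext this)
    · rintro i x ⟨hx, hx'⟩
      refine ⟨h3 i x hx, ?_⟩
      have hx'' := End.mem_eigenspace_iff.mp hx'
      refine End.mem_eigenspace_iff.mpr ?_
      rw [hc, hx'', map_smul]
    · intro i hi
      rcases Finset.mem_insert.mp hi with rfl | hi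
      · exact ⟨c, fun x hx => End.mem_eigenspace_iff.mp hx.2⟩
      · obtain ⟨d, hd⟩ := h4 i hi
        exact ⟨d, fun x hx => hd x hx.1⟩

lemma aux_dual [LieAlgebra.IsKilling k L] (h' : LieSubalgebra k L)
    (htop : ⨆ α : Dual k h', rootSpaceOf h' α = ⊤) (α : Dual k h') (x : L)
    (hx : x ∈ rootSpaceOf h' α) (hx0 : x ≠ 0) :
    ∃ y ∈ rootSpaceOf h' (-α), killingForm k L x y ≠ 0 := by
  by_contra! hcon
  have := LieAlgebra.IsKilling.killingForm_nondegenerate k L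
  refine hx0 (this.1 x fun z => ?_)
  have hz : z ∈ ⨆ α : Dual k h', rootSpaceOf h' α := by rw [htop]; trivial
  induction hz using Submodule.iSup_induction' with
  | mem β z hz =>
    by_cases hβ : β = -α
    · subst hβ; exact hcon z hz
    · have : ∃ H, α H + β H ≠ 0 := by
        by_contra! h0
        exact hβ (LinearMap.ext fun H => by
          have := h0 H
          simp only [LinearMap.neg_apply]
          linear_combination this)
      obtain ⟨H, hH⟩ := this
      have h1 : ⁅(H : L), x⁆ = α H • x := hx H
      have h2 : ⁅(H : L), z⁆ = β H • z := hz H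
      have h3 := LieModule.traceForm_apply_lie_apply' k L L (H : L) x z
      rw [h1, h2] at h3
      have h4 : (α H + β H) * killingForm k L x z = 0 := by
        simp only [map_smul, LinearMap.smul_apply, smul_eq_mul] at h3
        change α H * killingForm k L x z = -(β H * killingForm k L x z) at h3
        linear_combination h3
      exact (mul_eq_zero.mp h4).resolve_left hH
  | zero => simp
  | add _ _ _ _ h h' => simp [h, h']

lemma aux_pow {σ : L ≃ₗ[k] L} (z : L) (j : ℕ) : ((σ : L →ₗ[k] L) ^ j) z = (σ ^ j) z := by
  induction j with
  | zero => rfl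
  | succ j ih => rw [pow_succ', pow_succ', End.mul_apply, ih]; rfl

lemma aux_pair [LieAlgebra.IsKilling k L]
    {n : ℕ} (σ : Fin n → (L ≃ₗ[k] L))
    (hlie : ∀ i (x y : L), σ i ⁅x, y⁆ = ⁅σ i x, σ i y⁆)
    (hcomm : ∀ i j (x : L), σ i (σ j x) = σ j (σ i x))
    (hfin : ∀ i, IsOfFinOrder (σ i)) 
    (h : LieSubalgebra k ↥(fixedLieSubalgebra σ hlie))
    (hcartan : h.IsCartanSubalgebra)
    (h' : LieSubalgebra k L) (hh' : h' = h.map (fixedLieSubalgebra σ hlie).incl)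
    (htop : ⨆ α : Dual k h',
      rootSpaceOf h' α = ⊤)
    (α : Dual k h')
    (hα : rootSpaceOf h' α ≠ ⊥) :
    ∃ x ∈ rootSpaceOf h' α,
    ∃ y ∈ rootSpaceOf h' (-α),
      ⁅x, y⁆ ∈ h' ∧ killingForm k L x y ≠ 0 := by
  have hfix : ∀ H : h', ∀ i, σ i (H : L) = H := by
    rintro ⟨H, hH⟩ i
    rw [hh'] at hH
    obtain ⟨H, hH, rfl⟩ := hH
    exact H.2 i
  have hpres : ∀ β : Dual k h', ∀ i, ∀ x ∈ rootSpaceOf h' β, σ i x ∈ rootSpaceOf h' β := by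
    intro β i x hx H
    have h1 : ⁅(H : L), x⁆ = β H • x := hx H
    have h2 := hlie i H x
    rw [hfix, h1, map_smul] at h2
    exact h2.symm
  obtain ⟨x, hx, hx0, hxe⟩ := aux_eigen (fun i => (σ i : L →ₗ[k] L)) hcomm _ (hpres α) hα
  choose c hc using hxe
  replace hc : ∀ i, σ i x = c i • x := hc
  choose m hm0 hm using fun i => isOfFinOrder_iff_pow_eq_one.mp (hfin i)
  have hcm : ∀ i, c i ^ m i = 1 := by
    intro i
    have h1 : ∀ j : ℕ, (σ i ^ j) x = c i ^ j • x := by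
      intro j
      induction j with
      | zero => simp
      | succ j ih =>
        rw [pow_succ', LinearEquiv.mul_apply, ih, map_smul, hc, smul_smul, pow_succ]
    have h2 := h1 (m i)
    rw [hm i] at h2
    have h3 : (c i ^ m i - 1) • x = 0 := by
      rw [sub_smul, ← h2]; simp
    exact sub_eq_zero.mp ((smul_eq_zero.mp h3).resolve_right hx0)
  obtain ⟨y₀, hy₀, hxy₀⟩ := aux_dual h' htop α x hx hx0
  obtain ⟨y, hy, hyT, hyφ⟩ := aux_average (fun i => c i • (σ i : L →ₗ[k] L))
    (fun i j z => by simp [hcomm i j z, smul_comm (c i) (c j)]) m (fun i => (hm0 i).ne')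
    (fun i => by
      rw [smul_pow, hcm, one_smul]
      ext z
      rw [aux_pow, hm i]; rfl)
    (rootSpaceOf h' (-α))
    (fun i z hz => Submodule.smul_mem _ _ (hpres _ i z hz)) (killingForm k L x)
    (fun i z => by
      have := aux_killing (σ i) (hlie i) x z
      rw [hc i] at this
      simpa using this) y₀ hy₀
  refine ⟨x, hx, y, hy, ?_, by rw [hyφ]; exact hxy₀⟩
  have hG : ⁅x, y⁆ ∈ fixedLieSubalgebra σ hlie := by
    intro i
    have h1 : c i • σ i y = y := hyT i
    rw [hlie, hc, smul_lie, ← lie_smul, h1]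
  rw [hh']
  refine ⟨⟨⁅x, y⁆, hG⟩, ?_, rfl⟩
  suffices (⟨⁅x, y⁆, hG⟩ : fixedLieSubalgebra σ hlie) ∈ h.normalizer by
    rw [LieSubalgebra.IsCartanSubalgebra.self_normalizing] at this
    exact this
  rw [LieSubalgebra.mem_normalizer_iff']
  intro H hH
  have : ⁅H, (⟨⁅x, y⁆, hG⟩ : fixedLieSubalgebra σ hlie)⁆ = 0 := by
    apply Subtype.ext
    let H' : h' := ⟨H, hh' ▸ ⟨H, hH, rfl⟩⟩
    have h1 : ⁅(H : L), x⁆ = α H' • x := hx H'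
    have h2 : ⁅(H : L), y⁆ = (-α) H' • y := hy H'
    change ⁅(H : L), ⁅x, y⁆⁆ = 0
    rw [leibniz_lie, h1, h2]
    simp
  rw [this]; exact h.zero_mem

end

section
set_option linter.unusedSectionVars false
variable {k L : Type*} [Field k] [IsAlgClosed k] [CharZero k]
    [LieRing L] [LieAlgebra k L] [FiniteDimensional k L]

/-- If `⁅x, y⁆` commutes with `x` and `y`, it only has eigenvalue zero. -/
lemma aux_eigen_zero (t x y : L) (hxy : ⁅x, y⁆ = t) (htx : ⁅t, x⁆ = 0) (hty : ⁅t, y⁆ = 0)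
    (c : k) (hc : (ad k L t).HasEigenvalue c) : c = 0 := by
  set E := (ad k L t).eigenspace c with hE
  have hpx : ∀ z : L, ⁅t, z⁆ = 0 → ∀ v ∈ E, ad k L z v ∈ E := by
    intro z hz v hv
    have hv' : ⁅t, v⁆ = c • v := End.mem_eigenspace_iff.mp hv
    refine End.mem_eigenspace_iff.mpr ?_
    rw [ad_apply, ad_apply, leibniz_lie, hz, hv']
    simp
  let X := (ad k L x).restrict (hpx x htx)
  let Y := (ad k L y).restrict (hpx y hty)
  have h1 : X * Y - Y * X = c • (1 : End k E) := by
    ext v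
    have hv' : ⁅t, (v : L)⁆ = c • (v : L) := End.mem_eigenspace_iff.mp v.2
    change ⁅x, ⁅y, (v : L)⁆⁆ - ⁅y, ⁅x, (v : L)⁆⁆ = c • (v : L)
    rw [← hv', ← hxy, lie_lie]
  have h2 := congrArg (LinearMap.trace k E) h1
  rw [map_sub, LinearMap.trace_mul_comm, sub_self, map_smul, LinearMap.trace_one] at h2
  have h3 : (finrank k E : k) ≠ 0 := by
    have : E ≠ ⊥ := hc
    have : Nontrivial E := Submodule.nontrivial_iff_ne_bot.mpr this
    exact_mod_cast (finrank_pos (R := k) (M := E)).ne'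
  have h4 := h2.symm
  rw [smul_eq_mul] at h4
  exact (mul_eq_zero.mp h4).resolve_right h3

lemma aux_mem_add (h' : LieSubalgebra k L) (α β : Dual k h') (x y : L)
    (hx : x ∈ rootSpaceOf h' α) (hy : y ∈ rootSpaceOf h' β) :
    ⁅x, y⁆ ∈ rootSpaceOf h' (α + β) := by
  intro H
  have h1 : ⁅(H : L), x⁆ = α H • x := hx H
  have h2 : ⁅(H : L), y⁆ = β H • y := hy H
  rw [leibniz_lie, h1, h2, smul_lie, lie_smul, ← add_smul]; rfl

lemma aux_mem_pow (h' : LieSubalgebra k L) (α β : Dual k h') (x y : L)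
    (hx : x ∈ rootSpaceOf h' α) (hy : y ∈ rootSpaceOf h' β) (j : ℕ) :
    (toEnd k L L x ^ j) y ∈ rootSpaceOf h' (β + (j : k) • α) := by
  induction j with
  | zero => simpa using hy
  | succ j ih =>
    rw [pow_succ', End.mul_apply]
    have := aux_mem_add h' α _ x _ hx ih
    have e : β + ((j + 1 : ℕ) : k) • α = α + (β + (j : k) • α) := by
      push_cast; rw [add_smul, one_smul]; abel
    rw [e]; exact this

lemma aux_string (h' : LieSubalgebra k L) (α β : Dual k h') (H : h') (e f : L)
    (t : IsSl2Triple (H : L) e f) (he : e ∈ rootSpaceOf h' α) (hf : f ∈ rootSpaceOf h' (-α))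
    (hβ : rootSpaceOf h' β ≠ ⊥) :
    ∃ z : ℤ, β H = z ∧ (0 ≤ z → rootSpaceOf h' (β - (z : k) • α) ≠ ⊥) := by
  obtain ⟨v, hv, hv0⟩ := Submodule.exists_mem_ne_zero_of_ne_bot hβ
  have hHv : ⁅(H : L), v⁆ = β H • v := hv H
  have h_exists_zero : ∃ j : ℕ, (toEnd k L L e ^ j) v = 0 := by
    by_contra! contra
    let evals (n : ℕ) : k := β H + 2 * (n : k)
    have h_inj : Function.Injective evals := fun a b hab ↦ by
      simpa [evals, add_right_inj, mul_eq_mul_left_iff, Nat.cast_inj] using hab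
    have aux (μ : Set.range evals) : (toEnd k L L (H : L)).HasEigenvector μ
        ((toEnd k L L e ^ μ.property.choose) v) := by
      set n := μ.property.choose
      refine ⟨?_, contra n⟩
      rw [Module.End.mem_eigenspace_iff, toEnd_apply_apply, ← μ.property.choose_spec]
      exact t.lie_h_pow_toEnd_e hHv n
    have _i := ((toEnd k L L (H : L)).eigenvectors_linearIndependent (Set.range evals) _ aux).finite
    exact (Set.infinite_range_of_injective h_inj) (Set.toFinite _)
  obtain ⟨p, hp, hp0⟩ := Nat.exists_not_and_succ_of_not_zero_of_exists
    (p := fun j => (toEnd k L L e ^ j) v = 0) hv0 h_exists_zero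
  have P : IsSl2Triple.HasPrimitiveVectorWith t ((toEnd k L L e ^ p) v) (β H + 2 * (p : k)) :=
    { ne_zero := hp
      lie_h := t.lie_h_pow_toEnd_e hHv p
      lie_e := by rw [IsSl2Triple.lie_e_pow_toEnd_e]; exact hp0 }
  obtain ⟨N, hN⟩ := P.exists_nat
  refine ⟨(N : ℤ) - 2 * p, ?_, fun hz => ?_⟩
  · push_cast; linear_combination hN
  · have hle : p ≤ N := by omega
    have h1 := P.pow_toEnd_f_ne_zero_of_eq_nat hN (i := N - p) (Nat.sub_le _ _)
    have h2 := aux_mem_pow h' _ _ f _ hf (aux_mem_pow h' α β e v he hv p) (N - p)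
    have e1 : β + (p : k) • α + ((N - p : ℕ) : k) • -α =
        β - (((N : ℤ) - 2 * p : ℤ) : k) • α := by
      rw [Nat.cast_sub hle]; push_cast
      module
    rw [e1] at h2
    intro hb
    rw [hb] at h2
    exact h1 h2

section
variable [LieAlgebra.IsKilling k L] (h' : LieSubalgebra k L)

lemma aux_triple
    (hnd : ∀ x ∈ h', (∀ y ∈ h', killingForm k L x y = 0) → x = 0)
    (hpair : ∀ α : Dual k h', rootSpaceOf h' α ≠ ⊥ → ∃ x ∈ rootSpaceOf h' α,
      ∃ y ∈ rootSpaceOf h' (-α), ⁅x, y⁆ ∈ h' ∧ killingForm k L x y ≠ 0)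
    (α : Dual k h') (hα : rootSpaceOf h' α ≠ ⊥) (t : h')
    (ht : ∀ H : h', killingForm k L (t : L) (H : L) = α H) :
    ∃ x ∈ rootSpaceOf h' α, ∃ y ∈ rootSpaceOf h' (-α), ⁅x, y⁆ = t := by
  obtain ⟨x, hx, y, hy, hxy, hκ⟩ := hpair α hα
  refine ⟨x, hx, (killingForm k L x y)⁻¹ • y, Submodule.smul_mem _ _ hy, ?_⟩
  rw [← sub_eq_zero]
  refine hnd _ (h'.sub_mem (by rw [lie_smul]; exact h'.smul_mem _ hxy) t.2) fun H hH => ?_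
  have h2 : ⁅H, y⁆ = (-α) ⟨H, hH⟩ • y := hy ⟨H, hH⟩
  have h1 : killingForm k L ⁅x, y⁆ H = α ⟨H, hH⟩ * killingForm k L x y := by
    have h3 : killingForm k L ⁅x, y⁆ H = killingForm k L x ⁅y, H⁆ :=
      LieModule.traceForm_apply_lie_apply k L L x y H
    rw [h3, ← lie_skew, h2]
    simp
  have h4 := ht ⟨H, hH⟩
  simp only at h4
  rw [map_sub, LinearMap.sub_apply, h4, lie_smul, map_smul, LinearMap.smul_apply, h1, smul_eq_mul]
  field_simp
  simp

lemma aux_nonisotropic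
    (hss : ∀ x ∈ h', (ad k L x).IsSemisimple)
    (hnd : ∀ x ∈ h', (∀ y ∈ h', killingForm k L x y = 0) → x = 0)
    (hpair : ∀ α : Dual k h', rootSpaceOf h' α ≠ ⊥ → ∃ x ∈ rootSpaceOf h' α,
      ∃ y ∈ rootSpaceOf h' (-α), ⁅x, y⁆ ∈ h' ∧ killingForm k L x y ≠ 0)
    (α : Dual k h') (hα0 : α ≠ 0) (hα : rootSpaceOf h' α ≠ ⊥) (t : h')
    (ht : ∀ H : h', killingForm k L (t : L) (H : L) = α H) : α t ≠ 0 := by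
  intro h0
  obtain ⟨x, hx, y, hy, hxy⟩ := aux_triple h' hnd hpair α hα t ht
  have h1 : ⁅(t : L), x⁆ = α t • x := hx t
  have h2 : ⁅(t : L), y⁆ = (-α) t • y := hy t
  have h3 : ad k L (t : L) = 0 := by
    rw [(hss t t.2).eq_zero_iff_forall_eigenvalue]
    intro c hc
    exact aux_eigen_zero (t : L) x y hxy (by rw [h1, h0, zero_smul])
      (by rw [h2, LinearMap.neg_apply, h0, neg_zero, zero_smul]) c hc
  have h4 := aux_ad_zero _ h3
  apply hα0
  ext H
  rw [← ht H, h4]; simp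

lemma aux_reflect
    (hss : ∀ x ∈ h', (ad k L x).IsSemisimple)
    (hnd : ∀ x ∈ h', (∀ y ∈ h', killingForm k L x y = 0) → x = 0)
    (hpair : ∀ α : Dual k h', rootSpaceOf h' α ≠ ⊥ → ∃ x ∈ rootSpaceOf h' α,
      ∃ y ∈ rootSpaceOf h' (-α), ⁅x, y⁆ ∈ h' ∧ killingForm k L x y ≠ 0)
    (α : Dual k h') (hα0 : α ≠ 0) (hα : rootSpaceOf h' α ≠ ⊥)
    (β : Dual k h') (hβ0 : β ≠ 0) (hβ : rootSpaceOf h' β ≠ ⊥) (t : h')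
    (ht : ∀ H : h', killingForm k L (t : L) (H : L) = α H) :
    (∃ z : ℤ, 2 / killingForm k L (t : L) (t : L) * β t = (z : k)) ∧
      (β - (2 / killingForm k L (t : L) (t : L) * β t) • α ≠ 0 ∧
        rootSpaceOf h' (β - (2 / killingForm k L (t : L) (t : L) * β t) • α) ≠ ⊥) := by
  have hne := aux_nonisotropic h' hss hnd hpair α hα0 hα t ht
  obtain ⟨x, hx, y, hy, hxy⟩ := aux_triple h' hnd hpair α hα t ht
  have hx1 : ⁅(t : L), x⁆ = α t • x := hx t
  have hy1 : ⁅(t : L), y⁆ = (-α) t • y := hy t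
  rw [ht t]
  set a := α t with ha
  have T : IsSl2Triple (((2 / a) • t : h') : L) x ((2 / a) • y) :=
    { h_ne_zero := by
        intro h0
        have h1 : (2 / a) • t = 0 := Subtype.ext h0
        have h2 : t = 0 := (smul_eq_zero.mp h1).resolve_left (div_ne_zero two_ne_zero hne)
        apply hne
        rw [ha, h2, map_zero]
      lie_e_f := by rw [lie_smul, hxy]; rfl
      lie_h_e_nsmul := by
        change ⁅(2 / a) • (t : L), x⁆ = _
        rw [smul_lie, hx1, smul_smul, div_mul_cancel₀ _ hne, two_smul, two_smul]
      lie_h_f_nsmul := by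
        change ⁅(2 / a) • (t : L), _⁆ = _
        rw [smul_lie, lie_smul, hy1, LinearMap.neg_apply, ← ha, two_smul]
        match_scalars
        field_simp
        norm_num }
  have hy' : (2 / a) • y ∈ rootSpaceOf h' (-α) := Submodule.smul_mem _ _ hy
  have hval : β ((2 / a) • t) = 2 / a * β t := by simp
  obtain ⟨z, hz, hz1⟩ := aux_string h' α β _ _ _ T hx hy' hβ
  have T' : IsSl2Triple ((-((2 / a) • t) : h') : L) ((2 / a) • y) x := T.symm
  obtain ⟨w, hw, hw1⟩ := aux_string h' (-α) β _ _ _ T' hy' (by rwa [neg_neg]) hβ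
  rw [← hval]
  refine ⟨⟨z, hz⟩, ?_, ?_⟩
  · intro h0
    have h1 := LinearMap.congr_fun h0 ((2 / a) • t)
    have h2 : α ((2 / a) • t) = 2 := by
      rw [map_smul, smul_eq_mul, ← ha, div_mul_cancel₀ _ hne]
    simp only [LinearMap.sub_apply, LinearMap.smul_apply, smul_eq_mul, h2, LinearMap.zero_apply]
      at h1
    have h3 : β ((2 / a) • t) = 0 := by linear_combination -h1
    rw [h3, zero_smul, sub_zero] at h0
    exact hβ0 h0
  · rcases le_total 0 z with h0 | h0
    · rw [hz]; exact hz1 h0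
    · have hwz : w = -z := by
        rw [map_neg, hz] at hw
        exact_mod_cast hw.symm
      have := hw1 (by omega)
      rw [hwz] at this
      rw [hz]
      convert this using 2
      push_cast
      module

lemma aux_exists_t
    (hnd : ∀ x ∈ h', (∀ y ∈ h', killingForm k L x y = 0) → x = 0)
    (α : Dual k h') :
    ∃ t : h', ∀ H : h', killingForm k L (t : L) (H : L) = α H := by
  let B : h' →ₗ[k] Dual k h' := (killingForm k L).restrict h'.toSubmodule
  have hinj : Function.Injective B := by
    rw [injective_iff_map_eq_zero]
    intro x hx
    exact Subtype.ext (hnd x x.2 fun y hy => LinearMap.congr_fun hx ⟨y, hy⟩)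
  have hsurj : Function.Surjective B :=
    (LinearMap.injective_iff_surjective_of_finrank_eq_finrank
      (Subspace.dual_finrank_eq (K := k) (V := h')).symm).mp hinj
  obtain ⟨t, ht⟩ := hsurj α
  exact ⟨t, fun H => LinearMap.congr_fun ht H⟩

lemma aux_span (htop : ⨆ α : Dual k h', rootSpaceOf h' α = ⊤) :
    Submodule.span k {α : Dual k h' | α ≠ 0 ∧ rootSpaceOf h' α ≠ ⊥} = ⊤ := by
  by_contra hne
  obtain ⟨f, hf0, hf⟩ := Submodule.exists_le_ker_of_lt_top _ (lt_top_iff_ne_top.mpr hne)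
  obtain ⟨H, rfl⟩ := (evalEquiv k h').surjective f
  apply hf0
  have h1 : ad k L (H : L) = 0 := by
    ext v
    have hv : v ∈ ⨆ α : Dual k h', rootSpaceOf h' α := by rw [htop]; trivial
    induction hv using Submodule.iSup_induction' with
    | mem β v hv =>
      have h2 : ⁅(H : L), v⁆ = β H • v := hv H
      rw [ad_apply, h2]
      by_cases hv0 : v = 0
      · simp [hv0]
      · have h3 : β H = 0 := by
          by_cases hβ : β = 0
          · simp [hβ]
          · refine hf (Submodule.subset_span ⟨hβ, fun hb => hv0 ?_⟩)
            rw [hb] at hv; exact hv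
        rw [h3]; simp
    | zero => simp
    | add _ _ _ _ h1 h2 => simp only [map_add, h1, h2]
  have h2 : H = 0 := Subtype.ext (aux_ad_zero _ h1)
  rw [h2, map_zero]

lemma aux_irred
    (hss : ∀ x ∈ h', (ad k L x).IsSemisimple)
    (hnd : ∀ x ∈ h', (∀ y ∈ h', killingForm k L x y = 0) → x = 0)
    (hpair : ∀ α : Dual k h', rootSpaceOf h' α ≠ ⊥ → ∃ x ∈ rootSpaceOf h' α,
      ∃ y ∈ rootSpaceOf h' (-α), ⁅x, y⁆ ∈ h' ∧ killingForm k L x y ≠ 0)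
    [LieAlgebra.IsSimple k L] (htop : ⨆ α : Dual k h', rootSpaceOf h' α = ⊤)
    (Δ₁ Δ₂ : Set (Dual k h'))
    (hU : Δ₁ ∪ Δ₂ = {α : Dual k h' | α ≠ 0 ∧ rootSpaceOf h' α ≠ ⊥})
    (horth : ∀ α ∈ Δ₁, ∀ β ∈ Δ₂, ∀ Hα : h',
        (∀ H' : h', killingForm k L (Hα : L) (H' : L) = α H') → β Hα = 0)
    (hne : Δ₁.Nonempty) : Δ₂ = ∅ := by
  by_contra hne2
  obtain ⟨β₀, hβ₀⟩ := Set.nonempty_iff_ne_empty.mpr hne2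
  obtain ⟨α₀, hα₀⟩ := hne
  have m1 : ∀ α ∈ Δ₁, α ≠ 0 ∧ rootSpaceOf h' α ≠ ⊥ := fun α hα => by
    have : α ∈ Δ₁ ∪ Δ₂ := Or.inl hα
    rw [hU] at this; exact this
  have m2 : ∀ α ∈ Δ₂, α ≠ 0 ∧ rootSpaceOf h' α ≠ ⊥ := fun α hα => by
    have : α ∈ Δ₁ ∪ Δ₂ := Or.inr hα
    rw [hU] at this; exact this
  have hcomm : ∀ α ∈ Δ₁, ∀ β ∈ Δ₂, ∀ x ∈ rootSpaceOf h' α, ∀ y ∈ rootSpaceOf h' β,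
      ⁅x, y⁆ = 0 := by
    intro α hα β hβ x hx y hy
    by_contra hxy
    obtain ⟨t, ht⟩ := aux_exists_t h' hnd α
    obtain ⟨u, hu⟩ := aux_exists_t h' hnd β
    have n1 := aux_nonisotropic h' hss hnd hpair α (m1 α hα).1 (m1 α hα).2 t ht
    have n2 := aux_nonisotropic h' hss hnd hpair β (m2 β hβ).1 (m2 β hβ).2 u hu
    have o1 : β t = 0 := horth α hα β hβ t ht
    have o2 : α u = 0 := by
      rw [← ht u]
      have : killingForm k L (t : L) (u : L) = killingForm k L (u : L) (t : L) :=
        LieModule.traceForm_comm k L L _ _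
      rw [this, hu t, o1]
    have hs : rootSpaceOf h' (α + β) ≠ ⊥ := fun hb => by
      have := aux_mem_add h' α β x y hx hy
      rw [hb] at this
      exact hxy this
    have hs0 : α + β ≠ 0 := fun h0 => by
      have := LinearMap.congr_fun h0 t
      rw [LinearMap.add_apply, o1, add_zero] at this
      exact n1 this
    have hmem : α + β ∈ Δ₁ ∪ Δ₂ := by rw [hU]; exact ⟨hs0, hs⟩
    rcases hmem with hm | hm
    · obtain ⟨w, hw⟩ := aux_exists_t h' hnd (α + β)
      have h1 := horth _ hm β hβ w hw
      rw [← hu w] at h1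
      have : killingForm k L (u : L) (w : L) = killingForm k L (w : L) (u : L) :=
        LieModule.traceForm_comm k L L _ _
      rw [this, hw u, LinearMap.add_apply, o2, zero_add] at h1
      exact n2 h1
    · have h1 := horth α hα _ hm t ht
      rw [LinearMap.add_apply, o1, add_zero] at h1
      exact n1 h1
  let C : LieIdeal k L :=
    { carrier := {x | ∀ β ∈ Δ₂, ∀ y ∈ rootSpaceOf h' β, ⁅x, y⁆ = 0}
      add_mem' := fun {a b} ha hb β hβ y hy => by rw [add_lie, ha β hβ y hy, hb β hβ y hy, add_zero]
      zero_mem' := fun β hβ y hy => zero_lie y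
      smul_mem' := fun c x hx β hβ y hy => by rw [smul_lie, hx β hβ y hy, smul_zero]
      lie_mem := by
        intro z x hx
        have hz : z ∈ ⨆ α : Dual k h', rootSpaceOf h' α := by rw [htop]; trivial
        induction hz using Submodule.iSup_induction' with
        | mem γ z hz =>
          intro β hβ y hy
          by_cases hz0 : z = 0
          · simp [hz0]
          have hγb : rootSpaceOf h' γ ≠ ⊥ := fun hb => hz0 (by rw [hb] at hz; exact hz)
          have hx' : ∀ β ∈ Δ₂, ∀ y ∈ rootSpaceOf h' β, ⁅x, y⁆ = 0 := hx
          by_cases hγ : γ = 0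
          · subst hγ
            have h1 := aux_mem_add h' 0 β z y hz hy
            rw [zero_add] at h1
            rw [lie_lie, hx' β hβ y hy, hx' β hβ _ h1]; simp
          · have hm : γ ∈ Δ₁ ∪ Δ₂ := by rw [hU]; exact ⟨hγ, hγb⟩
            rcases hm with hm | hm
            · rw [lie_lie, hx' β hβ y hy, hcomm γ hm β hβ z hz y hy]; simp
            · rw [← lie_skew z x, hx' γ hm z hz]; simp
        | zero => intro β hβ y hy; simp
        | add a b _ _ ha hb =>
          intro β hβ y hy
          have ha' : ⁅⁅a, x⁆, y⁆ = 0 := ha β hβ y hy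
          have hb' : ⁅⁅b, x⁆, y⁆ = 0 := hb β hβ y hy
          rw [add_lie, add_lie, ha', hb', add_zero] }
  have hC : ∀ x, x ∈ C ↔ ∀ β ∈ Δ₂, ∀ y ∈ rootSpaceOf h' β, ⁅x, y⁆ = 0 := fun x => Iff.rfl
  obtain ⟨a, ha, ha0⟩ := Submodule.exists_mem_ne_zero_of_ne_bot (m1 α₀ hα₀).2
  obtain ⟨b, hb, hb0⟩ := Submodule.exists_mem_ne_zero_of_ne_bot (m2 β₀ hβ₀).2
  rcases LieAlgebra.IsSimple.eq_bot_or_eq_top (R := k) C with h0 | h0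
  · have : a ∈ C := (hC a).mpr fun β hβ y hy => hcomm α₀ hα₀ β hβ a ha y hy
    rw [h0] at this
    exact ha0 (by simpa using this)
  · apply hb0
    refine aux_ad_zero (k := k) b (LinearMap.ext fun z => ?_)
    have : z ∈ C := by rw [h0]; trivial
    rw [ad_apply, ← lie_skew, (hC z).mp this β₀ hβ₀ b hb]; simp

end
end

end

/-- for `g` finite dimensional simple over an algebraically closed field of
characteristic zero, `σ` commuting finite-order automorphisms with `g^σ ≠ 0` and `h` a Cartan
subalgebra of `g^σ`, the set `Δ = supp_{h*}(g) \ {0}` is an irreducible (possibly non-reduced)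
finite root system: it is finite, spans `h*`, the Cartan integers `⟨β, h_α⟩` are integers, the
reflections `s_α` preserve `Δ`, and `Δ` admits no partition into two orthogonal parts with one
nonempty and the other nonempty. -/
theorem roots_of_cartan_of_fixed_form_irreducible_root_system
    (k L : Type*) [Field k] [IsAlgClosed k] [CharZero k]
    [LieRing L] [LieAlgebra k L] [FiniteDimensional k L] [LieAlgebra.IsSimple k L]
    {n : ℕ} (σ : Fin n → (L ≃ₗ[k] L))
    (hlie : ∀ i (x y : L), σ i ⁅x, y⁆ = ⁅σ i x, σ i y⁆)
    (hcomm : ∀ i j (x : L), σ i (σ j x) = σ j (σ i x))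
    (hfin : ∀ i, IsOfFinOrder (σ i))
    (hne : fixedLieSubalgebra σ hlie ≠ ⊥)
    (h : LieSubalgebra k ↥(fixedLieSubalgebra σ hlie))
    (hcartan : h.IsCartanSubalgebra) :
    let h' : LieSubalgebra k L := h.map (fixedLieSubalgebra σ hlie).incl
    let Δ : Set (Module.Dual k ↥h') := {α | α ≠ 0 ∧ rootSpaceOf h' α ≠ ⊥}
    Δ.Finite ∧
    Submodule.span k Δ = ⊤ ∧
    (∀ α ∈ Δ, ∀ β ∈ Δ, ∀ Hα : ↥h',
      (∀ H' : ↥h', killingForm k L (Hα : L) (H' : L) = α H') →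
        (∃ z : ℤ, 2 / killingForm k L (Hα : L) (Hα : L) * β Hα = (z : k)) ∧
        (β - (2 / killingForm k L (Hα : L) (Hα : L) * β Hα) • α) ∈ Δ) ∧
    (∀ Δ₁ Δ₂ : Set (Module.Dual k ↥h'), Δ₁ ∪ Δ₂ = Δ →
      (∀ α ∈ Δ₁, ∀ β ∈ Δ₂, ∀ Hα : ↥h',
        (∀ H' : ↥h', killingForm k L (Hα : L) (H' : L) = α H') → β Hα = 0) →
      Δ₁.Nonempty → Δ₂ = ∅) := by
  intro h' Δ
  have := hcartan
  have hG := aux_fixed_nondeg σ hlie hcomm hfin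
  have hJ := aux_fixed_jordan σ hlie
  have hss0 := aux_h_semisimple (fixedLieSubalgebra σ hlie) h hG hJ
  have hss : ∀ x ∈ h', (LieAlgebra.ad k L x).IsSemisimple := by
    rintro _ ⟨x, hx, rfl⟩
    exact hss0 x hx
  have hab : ∀ x ∈ h', ∀ y ∈ h', ⁅x, y⁆ = 0 := by
    rintro _ ⟨x, hx, rfl⟩ _ ⟨y, hy, rfl⟩
    exact aux_h_abelian _ h hss0 x y hx hy
  have hnd : ∀ x ∈ h', (∀ y ∈ h', killingForm k L x y = 0) → x = 0 := by
    rintro _ ⟨x, hx, rfl⟩ h0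
    have := aux_h_nondeg _ h hG x hx (fun y hy => h0 _ ⟨y, hy, rfl⟩)
    rw [this]
    rfl
  have htop := aux_diag h' hab hss
  have hpair := fun α hα => aux_pair σ hlie hcomm hfin h hcartan h' rfl htop α hα
  exact ⟨aux_finite h' hab, aux_span h' htop,
    fun α hα β hβ t ht => aux_reflect h' hss hnd hpair α hα.1 hα.2 β hβ.1 hβ.2 t ht,
    fun Δ₁ Δ₂ hU ho hne => aux_irred h' hss hnd hpair htop Δ₁ Δ₂ hU ho hne⟩
end

section
/- Let g be a finite dimensional simple Lie algebra over an algebraically closed field k of characteristic 0, graded by Q_h × Λ̄ via a Cartan subalgebra h of g^σ and commuting finite-order automorphisms σ. If g_α^λ̄ ≠ 0 for some nonzero root α and λ̄ ∈ Λ̄, then g_{2α}^{2λ̄} = 0. -/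
theorem last_nonzero {k V : Type*} [Field k] [AddCommGroup V] [Module k V]
    (A : Module.End k V) (v : V) (hv : v ≠ 0) (N : ℕ) (hN : (A ^ N) v = 0) :
    ∃ j, (A ^ j) v ≠ 0 ∧ (A ^ (j + 1)) v = 0 := by
  induction N with
  | zero => exact absurd (by simpa using hN) hv
  | succ N ih =>
    by_cases h : (A ^ N) v = 0
    · exact ih h
    · exact ⟨N, h, hN⟩

theorem comm_pow_formula {k V : Type*} [Field k] [AddCommGroup V] [Module k V]
    (E F T : Module.End k V) (c : k) (hT : E * F = F * E + T) (hc : E * T = T * E - c • E) (N : ℕ) :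
    (2 : k) • (E ^ (N + 1) * F) = (2 : k) • (F * E ^ (N + 1)) +
      ((N : k) + 1) • ((2 : k) • (T * E ^ N) - (c * N) • E ^ N) := by
  induction N with
  | zero => simp [hT]
  | succ N ih =>
    have h1 : (2 : k) • (E ^ (N + 1 + 1) * F) = E * ((2 : k) • (E ^ (N + 1) * F)) := by
      rw [mul_smul_comm, pow_succ' E (N + 1), mul_assoc]
    have h2 : E * (T * E ^ N) = T * E ^ (N + 1) - c • E ^ (N + 1) := by
      rw [← mul_assoc, hc, sub_mul, smul_mul_assoc, mul_assoc, ← pow_succ']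
    have h3 : E * (F * E ^ (N + 1)) = F * E ^ (N + 1 + 1) + T * E ^ (N + 1) := by
      rw [← mul_assoc, hT, add_mul, mul_assoc, ← pow_succ']
    rw [h1, ih, mul_add, mul_smul_comm, mul_smul_comm, mul_sub, mul_smul_comm, mul_smul_comm,
      h2, h3, ← pow_succ']
    push_cast
    module

theorem eigen_of_ker {k V : Type*} [Field k] [CharZero k] [AddCommGroup V] [Module k V]
    (E F T : Module.End k V) (c : k) (hT : E * F = F * E + T) (hc : E * T = T * E - c • E)
    (hE : IsNilpotent E) (u : V) (hu : u ≠ 0) (hEu : E u = 0) (μ : k) (hTu : T u = μ • u) :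
    ∃ n : ℕ, 2 * μ = c * n := by
  by_contra hcon
  push Not at hcon
  have key : ∀ N : ℕ, ∃ v, (E ^ N) v = u := by
    intro N
    induction N with
    | zero => exact ⟨u, by simp⟩
    | succ N ih =>
      obtain ⟨v, hv⟩ := ih
      have h := congrArg (fun A : Module.End k V => A v) (comm_pow_formula E F T c hT hc N)
      have h0 : (E ^ (N + 1)) v = 0 := by rw [pow_succ', Module.End.mul_apply, hv, hEu]
      simp only [LinearMap.add_apply, LinearMap.smul_apply, LinearMap.sub_apply,
        Module.End.mul_apply, hv, hTu, h0, map_zero, smul_zero, zero_add] at h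
      have hd : ((N : k) + 1) * (2 * μ - c * N) ≠ 0 :=
        mul_ne_zero (by exact_mod_cast Nat.succ_ne_zero N) (sub_ne_zero.mpr (hcon N))
      refine ⟨(((N : k) + 1) * (2 * μ - c * N))⁻¹ • (2 : k) • F v, ?_⟩
      rw [map_smul, map_smul, h]
      have : ((N : k) + 1) • ((2 : k) • μ • u - (c * N) • u) =
        (((N : k) + 1) * (2 * μ - c * N)) • u := by module
      rw [this, smul_smul, inv_mul_cancel₀ hd, one_smul]
  obtain ⟨N, hN⟩ := hE
  obtain ⟨v, hv⟩ := key N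
  rw [hN] at hv
  exact hu (by simpa using hv.symm)

/-- Invariance of the Killing form under automorphisms. -/
theorem killing_inv {k L : Type*} [Field k] [LieRing L] [LieAlgebra k L] [FiniteDimensional k L]
    (s : L ≃ₗ[k] L) (hs : ∀ x y : L, s ⁅x, y⁆ = ⁅s x, s y⁆) (x y : L) :
    killingForm k L (s x) (s y) = killingForm k L x y := by
  rw [killingForm_apply_apply, killingForm_apply_apply, ← LinearMap.trace_conj' (LieAlgebra.ad k L x ∘ₗ _) s]
  congr 1
  ext w
  simp [LinearEquiv.conj_apply, hs]

theorem map_rootSpace_of_fixed {k L : Type*} [Field k] [LieRing L] [LieAlgebra k L]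
    (H : LieSubalgebra k L) [LieRing.IsNilpotent H]
    (s : L ≃ₗ[k] L) (hs : ∀ x y : L, s ⁅x, y⁆ = ⁅s x, s y⁆) (hfix : ∀ w ∈ H, s w = w)
    (β : H → k) (y : L) (hy : y ∈ LieAlgebra.rootSpace H β) :
    s y ∈ LieAlgebra.rootSpace H β := by
  rw [LieModule.mem_genWeightSpace] at hy ⊢
  intro w
  obtain ⟨N, hN⟩ := hy w
  refine ⟨N, ?_⟩
  have : ∀ (N : ℕ) (v : L), ((LieModule.toEnd k H L w - β w • 1) ^ N) (s v) =
      s (((LieModule.toEnd k H L w - β w • 1) ^ N) v) := by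
    intro N
    induction N with
    | zero => intro v; simp
    | succ N ih =>
      intro v
      rw [pow_succ, Module.End.mul_apply, Module.End.mul_apply, ← ih]
      congr 1
      have := hs w v
      rw [hfix w w.2] at this
      simp [LieSubalgebra.coe_bracket_of_module, this]
  rw [this, hN, map_zero]

theorem killing_orth {k L : Type*} [Field k] [IsAlgClosed k]
    [LieRing L] [LieAlgebra k L] [FiniteDimensional k L]
    (H : LieSubalgebra k L) [LieRing.IsNilpotent H] {α β : H → k} {x y : L}
    (hx : x ∈ LieAlgebra.rootSpace H α) (hy : y ∈ LieAlgebra.rootSpace H β) (hαβ : α + β ≠ 0) :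
    killingForm k L x y = 0 := by
  let s : (H → k) → (H → k) := fun γ ↦ α + (β + γ)
  have hs : ∀ γ, s γ ≠ γ := fun γ ↦ by simpa only [s, ← add_assoc] using add_ne_right.mpr hαβ
  let f : Module.End k L := (LieAlgebra.ad k L x) ∘ₗ (LieAlgebra.ad k L y)
  have hf : ∀ γ, Set.MapsTo f (LieAlgebra.rootSpace H γ) (LieAlgebra.rootSpace H (s γ)) :=
    fun γ v hv ↦ LieAlgebra.lie_mem_genWeightSpace_of_mem_genWeightSpace hx
      (LieAlgebra.lie_mem_genWeightSpace_of_mem_genWeightSpace hy hv)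
  classical
  have hds := DirectSum.isInternal_submodule_of_iSupIndep_of_iSup_eq_top
    (LieSubmodule.iSupIndep_toSubmodule.mpr <| LieModule.iSupIndep_genWeightSpace k H L)
    (LieSubmodule.iSup_toSubmodule_eq_top.mpr <| LieModule.iSup_genWeightSpace_eq_top k H L)
  exact LinearMap.trace_eq_zero_of_mapsTo_ne hds s hs hf

theorem pairing {k L : Type*} [Field k] [IsAlgClosed k] [CharZero k]
    [LieRing L] [LieAlgebra k L] [FiniteDimensional k L] [LieAlgebra.IsKilling k L]
    {n : ℕ} (σ : Fin n → (L ≃ₗ[k] L)) (m : Fin n → ℕ) (hm : ∀ i, 0 < m i)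
    (hlie : ∀ i (x y : L), σ i ⁅x, y⁆ = ⁅σ i x, σ i y⁆)
    (hcomm : ∀ i j (x : L), σ i (σ j x) = σ j (σ i x))
    (horder : ∀ i, σ i ^ (m i) = 1)
    (H : LieSubalgebra k L) [LieRing.IsNilpotent H] (hfix : ∀ i, ∀ w ∈ H, σ i w = w)
    (c : Fin n → k) (hc : ∀ i, c i ^ m i = 1)
    (β : H → k) (x : L) (hx0 : x ≠ 0) (hx : x ∈ LieAlgebra.rootSpace H β)
    (hxσ : ∀ i, σ i x = c i • x) :
    ∃ y ∈ LieAlgebra.rootSpace H (-β), killingForm k L x y ≠ 0 ∧ ∀ i, c i • σ i y = y := by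
  suffices h : ∀ S : Finset (Fin n), ∃ y ∈ LieAlgebra.rootSpace H (-β),
      killingForm k L x y ≠ 0 ∧ ∀ i ∈ S, c i • σ i y = y by
    simpa using h Finset.univ
  intro S
  induction S using Finset.induction_on with
  | empty =>
    by_contra hcon
    push Not at hcon
    have this : x ∈ LinearMap.ker (killingForm k L) := by
      rw [LinearMap.mem_ker]
      ext y
      have hy : y ∈ ⨆ γ : H → k, LieAlgebra.rootSpace H γ := by
        simp [LieModule.iSup_genWeightSpace_eq_top k H L]
      induction hy using LieSubmodule.iSup_induction' with
      | mem γ y hy =>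
        by_cases hαβ : β + γ = 0
        · by_contra h0
          obtain ⟨i, hi, -⟩ := hcon y (add_eq_zero_iff_neg_eq.mp hαβ ▸ hy) h0
          simp at hi
        · exact killing_orth H hx hy hαβ
      | zero => simp
      | add => simp_all
    rw [LieAlgebra.IsKilling.ker_killingForm_eq_bot] at this
    exact hx0 (by simpa using this)
  | insert i S hi ih =>
    obtain ⟨y, hy, hxy, hS⟩ := ih
    have hmem : ∀ j : ℕ, (σ i ^ j) y ∈ LieAlgebra.rootSpace H (-β) := by
      intro j
      induction j with
      | zero => simpa using hy
      | succ j ihj =>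
        rw [pow_succ', LinearEquiv.mul_apply]
        exact map_rootSpace_of_fixed H (σ i) (hlie i) (hfix i) _ _ ihj
    have hk : ∀ j : ℕ, c i ^ j * killingForm k L x ((σ i ^ j) y) = killingForm k L x y := by
      intro j
      induction j with
      | zero => simp
      | succ j ihj =>
        rw [← ihj, ← killing_inv (σ i) (hlie i) x ((σ i ^ j) y), hxσ, pow_succ' (σ i),
          LinearEquiv.mul_apply]
        simp only [map_smul, LinearMap.smul_apply, smul_eq_mul]
        ring
    have hcs : ∀ j : ℕ, ∀ q ∈ S, c q • σ q ((σ i ^ j) y) = (σ i ^ j) y := by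
      intro j q hq
      induction j with
      | zero => simpa using hS q hq
      | succ j ihj =>
        rw [pow_succ', LinearEquiv.mul_apply, hcomm q i, ← map_smul, ihj]
    refine ⟨∑ j ∈ Finset.range (m i), c i ^ j • (σ i ^ j) y, ?_, ?_, ?_⟩
    · exact sum_mem fun j _ => Submodule.smul_mem _ _ (hmem j)
    · rw [map_sum]
      simp only [map_smul, smul_eq_mul, hk, Finset.sum_const, Finset.card_range, nsmul_eq_mul]
      exact mul_ne_zero (by exact_mod_cast (hm i).ne') hxy
    · intro q hq
      rcases Finset.mem_insert.mp hq with rfl | hq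
      · rw [map_sum, Finset.smul_sum]
        have h1 : ∀ j, c q • σ q (c q ^ j • (σ q ^ j) y) = c q ^ (j + 1) • (σ q ^ (j + 1)) y := by
          intro j
          rw [map_smul, smul_smul, pow_succ' (σ q), LinearEquiv.mul_apply, pow_succ']
        simp only [h1]
        have h2 := Finset.sum_range_succ (fun j => c q ^ j • (σ q ^ j) y) (m q)
        rw [Finset.sum_range_succ'] at h2
        simp only [hc, horder, pow_zero] at h2
        exact add_right_cancel h2
      · rw [map_sum, Finset.smul_sum]
        refine Finset.sum_congr rfl fun j _ => ?_
        rw [map_smul, smul_comm, hcs j q hq]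

theorem core {k L : Type*} [Field k] [IsAlgClosed k] [CharZero k]
    [LieRing L] [LieAlgebra k L] [FiniteDimensional k L] [LieAlgebra.IsKilling k L]
    {n : ℕ} (σ : Fin n → (L ≃ₗ[k] L)) (m : Fin n → ℕ) (hm : ∀ i, 0 < m i)
    (hlie : ∀ i (x y : L), σ i ⁅x, y⁆ = ⁅σ i x, σ i y⁆)
    (hcomm : ∀ i j (x : L), σ i (σ j x) = σ j (σ i x))
    (horder : ∀ i, σ i ^ (m i) = 1)
    (H : LieSubalgebra k L) [LieRing.IsNilpotent H] (hfix : ∀ i, ∀ w ∈ H, σ i w = w)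
    (hcar : ∀ w : L, (∀ i, σ i w = w) → w ∈ LieAlgebra.rootSpace H (0 : H → k) → w ∈ H)
    (c : Fin n → k) (hc : ∀ i, c i ^ m i = 1)
    (α : Module.Dual k H) (hα0 : α ≠ 0) (x : L) (hx0 : x ≠ 0) (hx : x ∈ rootSpaceOf H α)
    (hxσ : ∀ i, σ i x = c i • x)
    (z : L) (hz : z ∈ rootSpaceOf H ((2 : k) • α)) (hzσ : ∀ i, σ i z = (c i ^ 2) • z) : z = 0 := by
  have toRoot : ∀ (β : Module.Dual k H) (v : L), v ∈ rootSpaceOf H β →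
      v ∈ LieAlgebra.rootSpace H (β : H → k) := by
    intro β v hv
    rw [LieModule.mem_genWeightSpace]
    intro w
    refine ⟨1, ?_⟩
    have := hv w
    simp [LieSubalgebra.coe_bracket_of_module, this]
  have hαf : (α : H → k) ≠ 0 := fun h => hα0 (DFunLike.coe_injective h)
  have hxr := toRoot α x hx
  have hxb : ∀ w : H, ⁅(w : L), x⁆ = α w • x := hx
  obtain ⟨y, hy, hxy, hyσ⟩ := pairing σ m hm hlie hcomm horder H hfix c hc α x hx0 hxr hxσ
  have htH : ⁅x, y⁆ ∈ H := by
    apply hcar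
    · intro i
      rw [hlie, hxσ, smul_lie, ← lie_smul, hyσ]
    · have := LieAlgebra.lie_mem_genWeightSpace_of_mem_genWeightSpace hxr hy
      rwa [add_neg_cancel] at this
  set t : H := ⟨⁅x, y⁆, htH⟩ with ht
  have htL : (t : L) = ⁅x, y⁆ := rfl
  set a := α t with ha
  set E := LieAlgebra.ad k L x
  set F := LieAlgebra.ad k L y
  set T := LieAlgebra.ad k L (t : L)
  have hEF : E * F = F * E + T := by
    ext v
    simp [E, F, T, htL]
  have hET : E * T = T * E - a • E := by
    ext v
    have h1 : ⁅(t : L), ⁅x, v⁆⁆ = a • ⁅x, v⁆ + ⁅x, ⁅(t : L), v⁆⁆ := by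
      rw [leibniz_lie, hxb, smul_lie]
    simp only [E, T, Module.End.mul_apply, LieAlgebra.ad_apply, LinearMap.sub_apply,
      LinearMap.smul_apply, h1]
    abel
  have hEnil : IsNilpotent E := LieModule.isNilpotent_toEnd_of_mem_rootSpace (M := L) H hαf hxr
  have ha0 : a ≠ 0 := by
    intro ha0
    rw [ha0, zero_smul, sub_zero] at hET
    have hw : ∀ χ : LieModule.Weight k H L, χ t = 0 := by
      intro χ
      obtain ⟨v, hv0, hv⟩ := LieModule.exists_forall_lie_eq_smul k H L χ
      obtain ⟨N, hN⟩ := hEnil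
      obtain ⟨j, hj, hj'⟩ := last_nonzero E v hv0 N (by rw [hN]; rfl)
      have hTv : T v = χ t • v := hv t
      have hTu : T ((E ^ j) v) = χ t • (E ^ j) v := by
        have : Commute T (E ^ j) := Commute.pow_right hET.symm j
        rw [← Module.End.mul_apply, this.eq, Module.End.mul_apply, hTv, map_smul]
      obtain ⟨q, hq⟩ := eigen_of_ker E F T 0 hEF (by simpa using hET) ⟨N, hN⟩ _ hj
        (by rw [pow_succ', Module.End.mul_apply] at hj'; exact hj') _ hTu
      simpa using hq
    apply hα0
    ext w
    have h1 : LieModule.traceForm k H L t w = 0 := by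
      rw [LieModule.traceForm_eq_sum_finrank_nsmul_mul]
      simp [hw]
    have h2 : killingForm k L ⁅x, y⁆ w = 0 := h1
    have h3 : killingForm k L ⁅(w : L), x⁆ y = killingForm k L (w : L) ⁅x, y⁆ :=
      LieModule.traceForm_apply_lie_apply k L L _ _ _
    rw [LieModule.traceForm_comm k L L] at h2
    rw [h2, hxb, map_smul, LinearMap.smul_apply, smul_eq_mul] at h3
    simpa [hxy] using h3
  have noker : ∀ (β : H → k) (v : L), v ∈ LieAlgebra.rootSpace H β → E v = 0 →
      (∀ q : ℕ, 2 * β t ≠ a * q) → v = 0 := by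
    intro β v hv hEv hβ
    by_contra hv0
    rw [LieModule.mem_genWeightSpace] at hv
    obtain ⟨N, hN⟩ := hv t
    obtain ⟨j, hj, hj'⟩ := last_nonzero _ v hv0 N hN
    set A : Module.End k L := LieModule.toEnd k H L t - β t • 1 with hA
    have hAT : A = T - β t • 1 := rfl
    have hker : ∀ i : ℕ, E ((A ^ i) v) = 0 := by
      intro i
      induction i with
      | zero => simpa using hEv
      | succ i ih =>
        rw [pow_succ', Module.End.mul_apply, ← Module.End.mul_apply, hAT, mul_sub, hET, ← hAT]
        simp [ih]
    obtain ⟨q, hq⟩ := eigen_of_ker E F T a hEF hET hEnil _ hj (hker j) (β t) (by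
      rw [pow_succ', Module.End.mul_apply] at hj'
      rw [hAT] at hj' ⊢
      simpa [sub_eq_zero] using hj')
    exact hβ q hq
  by_contra hz0
  obtain ⟨y', hy', hzy', hy'σ⟩ := pairing σ m hm hlie hcomm horder H hfix (fun i => c i ^ 2)
    (fun i => by rw [← pow_mul, mul_comm, pow_mul, hc, one_pow]) _ z hz0 (toRoot _ z hz) hzσ
  have hs1 : ⁅x, y'⁆ ∈ LieAlgebra.rootSpace H (-(α : H → k)) := by
    have := LieAlgebra.lie_mem_genWeightSpace_of_mem_genWeightSpace hxr hy'
    convert this using 2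
    ext w
    simp
    ring
  have hs2 : ⁅x, ⁅x, y'⁆⁆ ∈ LieAlgebra.rootSpace H (0 : H → k) := by
    have := LieAlgebra.lie_mem_genWeightSpace_of_mem_genWeightSpace hxr hs1
    rwa [add_neg_cancel] at this
  have hs2σ : ∀ i, σ i ⁅x, ⁅x, y'⁆⁆ = ⁅x, ⁅x, y'⁆⁆ := by
    intro i
    conv_rhs => rw [← hy'σ i]
    rw [hlie, hlie, hxσ]
    simp only [smul_lie, lie_smul, smul_smul, pow_two]
  have hs20 : ⁅x, ⁅x, y'⁆⁆ = 0 := by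
    by_contra hne
    obtain ⟨w, hw, hkw, hwσ⟩ := pairing σ m hm hlie hcomm horder H hfix (fun _ => 1)
      (fun i => one_pow _) 0 _ hne hs2 (fun i => by rw [hs2σ, one_smul])
    rw [neg_zero] at hw
    have hwH : w ∈ H := hcar w (fun i => by simpa using hwσ i) hw
    apply hkw
    have h1 : ⁅x, ⁅x, w⁆⁆ = 0 := by
      have : ⁅x, w⁆ = -(α ⟨w, hwH⟩ • x) := by
        rw [← hxb ⟨w, hwH⟩, lie_skew]
      rw [this]; simp
    have inv : ∀ p q : L, killingForm k L ⁅x, p⁆ q = - killingForm k L p ⁅x, q⁆ := by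
      intro p q
      rw [← lie_skew, map_neg, LinearMap.neg_apply]
      congr 1
      exact LieModule.traceForm_apply_lie_apply k L L _ _ _
    rw [inv, inv, h1]; simp
  have hcast : ∀ q : ℕ, (q : k) + 2 ≠ 0 := fun q => by exact_mod_cast (by omega : q + 2 ≠ 0)
  have hcast' : ∀ q : ℕ, (q : k) + 4 ≠ 0 := fun q => by exact_mod_cast (by omega : q + 4 ≠ 0)
  have hs10 : ⁅x, y'⁆ = 0 := noker _ _ hs1 hs20 fun q hq => by
    have : a * ((q : k) + 2) = 0 := by
      have h : 2 * (-a) = a * q := hq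
      linear_combination -h
    exact mul_ne_zero ha0 (hcast q) this
  have hy'0 : y' = 0 := noker _ _ hy' hs10 fun q hq => by
    have : a * ((q : k) + 4) = 0 := by
      have h : 2 * (-(2 * a)) = a * q := hq
      linear_combination -h
    exact mul_ne_zero ha0 (hcast' q) this
  rw [hy'0] at hzy'
  simp at hzy'

/-- in the `Q_h × Λ̄` grading of `g` (root grading with respect to a Cartan
subalgebra `h` of `g^σ`, together with the simultaneous eigenspace grading by the commuting
finite-order automorphisms `σ`), if `g_α^λ̄ ≠ 0` for a nonzero root `α`, then
`g_{2α}^{2λ̄} = 0`. -/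
theorem double_root_space_eq_bot
    (k L : Type*) [Field k] [IsAlgClosed k] [CharZero k]
    [LieRing L] [LieAlgebra k L] [FiniteDimensional k L] [LieAlgebra.IsSimple k L]
    {n : ℕ} (σ : Fin n → (L ≃ₗ[k] L)) (m : Fin n → ℕ) (hm : ∀ i, 0 < m i)
    (ζ : Fin n → k) (hζ : ∀ i, IsPrimitiveRoot (ζ i) (m i))
    (hlie : ∀ i (x y : L), σ i ⁅x, y⁆ = ⁅σ i x, σ i y⁆)
    (hcomm : ∀ i j (x : L), σ i (σ j x) = σ j (σ i x))
    (horder : ∀ i, σ i ^ (m i) = 1)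
    (hne : fixedLieSubalgebra σ hlie ≠ ⊥)
    (h : LieSubalgebra k ↥(fixedLieSubalgebra σ hlie))
    (hcartan : h.IsCartanSubalgebra)
    (α : Module.Dual k ↥(h.map (fixedLieSubalgebra σ hlie).incl)) (hα0 : α ≠ 0)
    (l : Fin n → ℤ)
    (hex : ∃ x : L, x ≠ 0 ∧ x ∈ rootSpaceOf (h.map (fixedLieSubalgebra σ hlie).incl) α ∧
      ∀ i, σ i x = ζ i ^ (l i) • x) :
    ∀ z : L, z ∈ rootSpaceOf (h.map (fixedLieSubalgebra σ hlie).incl) ((2 : k) • α) →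
      (∀ i, σ i z = ζ i ^ (2 * l i) • z) → z = 0 := by
  obtain ⟨x, hx0, hx, hxσ⟩ := hex
  intro z hz hzσ
  have := hcartan
  have : LieRing.IsNilpotent h := hcartan.nilpotent
  have : LieRing.IsNilpotent ↥(h.map (fixedLieSubalgebra σ hlie).incl) :=
    (LieSubalgebra.equivMapOfInjective (f := (fixedLieSubalgebra σ hlie).incl) h
      Subtype.val_injective).nilpotent_iff_equiv_nilpotent.mp inferInstance
  have hcm : ∀ i, (ζ i ^ (l i)) ^ m i = 1 := by
    intro i
    rw [← zpow_natCast, ← zpow_mul, mul_comm, zpow_mul, zpow_natCast, (hζ i).pow_eq_one, one_zpow]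
  refine core σ m hm hlie hcomm horder (h.map (fixedLieSubalgebra σ hlie).incl) ?_ ?_ (fun i => ζ i ^ (l i)) hcm α hα0 x hx0
    hx hxσ z hz ?_
  · rintro i w hw
    obtain ⟨w', -, rfl⟩ := (LieSubalgebra.mem_map _ _ _).mp hw
    exact w'.2 i
  · intro w hwσ hw
    rw [LieSubalgebra.mem_map]
    refine ⟨⟨w, hwσ⟩, ?_, rfl⟩
    rw [← LieAlgebra.zeroRootSubalgebra_eq_of_is_cartan k (fixedLieSubalgebra σ hlie) h, LieAlgebra.mem_zeroRootSubalgebra]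
    intro v
    rw [LieModule.mem_genWeightSpace] at hw
    obtain ⟨N, hN⟩ := hw ⟨((v : fixedLieSubalgebra σ hlie) : L), (LieSubalgebra.mem_map _ _ _).mpr ⟨v, v.2, rfl⟩⟩
    refine ⟨N, ?_⟩
    have aux : ∀ (N : ℕ) (u : fixedLieSubalgebra σ hlie), (((LieModule.toEnd k h (fixedLieSubalgebra σ hlie) v ^ N) u : fixedLieSubalgebra σ hlie) : L) =
        ((LieModule.toEnd k (h.map (fixedLieSubalgebra σ hlie).incl) L ⟨((v : fixedLieSubalgebra σ hlie) : L),
          (LieSubalgebra.mem_map _ _ _).mpr ⟨v, v.2, rfl⟩⟩ ^ N) (u : L)) := by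
      intro N
      induction N with
      | zero => intro u; rfl
      | succ N ih =>
        intro u
        rw [pow_succ, pow_succ, Module.End.mul_apply, Module.End.mul_apply, ih]
        rfl
    apply Subtype.ext
    rw [aux]
    simpa using hN
  · intro i
    rw [hzσ i, mul_comm, zpow_mul]
    norm_cast
end

section
/- Let g be a finite dimensional simple Lie algebra over an algebraically closed field k of characteristic 0 with g^σ ≠ 0 for commuting finite-order automorphisms σ = (σ₁,…,σₙ) with σᵢ^{mᵢ} = id, h a Cartan subalgebra of g^σ and Q_h the root lattice. Given s = (s₁,…,sₙ) ∈ Hom(Q_h, Zⁿ), define τᵢ ∈ Aut(g) by τᵢ(x_α) = ζ_{mᵢ}^{-sᵢ(α)} x_α for x_α ∈ g_α. Then each τᵢ is an automorphism of g, the tuple τσ = (τ₁σ₁,…,τₙσₙ) consists of commuting finite-order automorphisms with (τσ)^m = id, and h is a Cartan subalgebra of g^{τσ}. -/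
namespace TwistAux

open LieAlgebra LieModule

section
variable {k L : Type*} [Field k] [IsAlgClosed k] [CharZero k]
    [LieRing L] [LieAlgebra k L] [FiniteDimensional k L] [LieAlgebra.IsSimple k L]

lemma eq_zero_of_lie (k : Type*) {L : Type*} [Field k] [CharZero k]
    [LieRing L] [LieAlgebra k L] [FiniteDimensional k L] [LieAlgebra.IsSimple k L] (y : L) (hy : ∀ z : L, ⁅y, z⁆ = 0) : y = 0 := by
  have : y ∈ LieAlgebra.center k L := by
    rw [LieModule.mem_maxTrivSubmodule]
    intro z
    rw [← lie_skew, hy, neg_zero]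
  simpa [LieAlgebra.center_eq_bot] using this

lemma commute_ad (k : Type*) {L : Type*} [Field k] [LieRing L] [LieAlgebra k L] (u v : L)
    (h : ⁅u, v⁆ = 0) : Commute (ad k L u) (ad k L v) := by
  apply LinearMap.ext
  intro w
  change ⁅u, ⁅v, w⁆⁆ = ⁅v, ⁅u, w⁆⁆
  rw [leibniz_lie, h, zero_lie, zero_add]

/-- Averaging. -/
lemma exists_avg {n : ℕ} (σ : Fin n → (L ≃ₗ[k] L)) (m : Fin n → ℕ) (hm : ∀ i, 0 < m i)
    (hlie : ∀ i (x y : L), σ i ⁅x, y⁆ = ⁅σ i x, σ i y⁆)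
    (hcomm : ∀ i j (x : L), σ i (σ j x) = σ j (σ i x))
    (horder : ∀ i, σ i ^ (m i) = 1) (y : L) (S : Finset (Fin n)) :
    ∃ y' : L, (∀ i ∈ S, σ i y' = y') ∧
      ∀ x ∈ fixedLieSubalgebra σ hlie, killingForm k L x y' = killingForm k L x y := by
  classical
  induction S using Finset.induction_on with
  | empty => exact ⟨y, by simp, fun _ _ => rfl⟩
  | insert i S hi ih =>
    obtain ⟨y', h1, h2⟩ := ih
    have hc : ∀ j (t : ℕ) (z : L), σ j ((σ i ^ t) z) = (σ i ^ t) (σ j z) := by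
      intro j t z
      induction t generalizing z with
      | zero => simp
      | succ t ih => rw [pow_succ, LinearEquiv.mul_apply, ih, hcomm, LinearEquiv.mul_apply]
    have hk : ∀ x ∈ fixedLieSubalgebra σ hlie, ∀ (t : ℕ) (z : L),
        killingForm k L x ((σ i ^ t) z) = killingForm k L x z := by
      intro x hx t z
      induction t generalizing z with
      | zero => simp
      | succ t ih =>
        rw [pow_succ, LinearEquiv.mul_apply, ih]
        let e : L ≃ₗ⁅k⁆ L := { σ i with map_lie' := fun {x y} => hlie i x y }
        have := LieAlgebra.killingForm_of_equiv_apply e x z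
        have hx' : e x = x := hx i
        rw [hx'] at this
        exact this
    refine ⟨(m i : k)⁻¹ • ∑ t ∈ Finset.range (m i), (σ i ^ t) y', ?_, ?_⟩
    · intro j hj
      rw [map_smul, map_sum]
      congr 1
      rcases Finset.mem_insert.mp hj with rfl | hj
      · have : ∀ t, σ j ((σ j ^ t) y') = (σ j ^ (t+1)) y' := fun t => by
          rw [pow_succ', LinearEquiv.mul_apply]
        simp_rw [this]
        have h3 := Finset.sum_range_succ (fun t => (σ j ^ t) y') (m j)
        rw [Finset.sum_range_succ', horder] at h3
        simpa using h3
      · simp_rw [hc, h1 j hj]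
    · intro x hx
      have : (m i : k) ≠ 0 := Nat.cast_ne_zero.mpr (hm i).ne'
      rw [map_smul, map_sum, Finset.sum_congr rfl fun t _ => hk x hx t y']
      simp [h2 x hx, this]

lemma nondeg {n : ℕ} (σ : Fin n → (L ≃ₗ[k] L)) (m : Fin n → ℕ) (hm : ∀ i, 0 < m i)
    (hlie : ∀ i (x y : L), σ i ⁅x, y⁆ = ⁅σ i x, σ i y⁆)
    (hcomm : ∀ i j (x : L), σ i (σ j x) = σ j (σ i x))
    (horder : ∀ i, σ i ^ (m i) = 1) (x : L) (hx : x ∈ fixedLieSubalgebra σ hlie)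
    (h : ∀ y ∈ fixedLieSubalgebra σ hlie, killingForm k L x y = 0) : x = 0 := by
  have : x ∈ LinearMap.ker (killingForm k L) := by
    rw [LinearMap.mem_ker]
    ext y
    obtain ⟨y', h1, h2⟩ := exists_avg σ m hm hlie hcomm horder y Finset.univ
    rw [← h2 x hx, h y' (fun i => h1 i (Finset.mem_univ i))]
    rfl
  simpa using this

lemma nondeg_cartan (a : LieSubalgebra k L)
    (ha : ∀ x ∈ a, (∀ y ∈ a, killingForm k L x y = 0) → x = 0)
    (h : LieSubalgebra k a) [h.IsCartanSubalgebra] (x : a) (hx : x ∈ h)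
    (hxy : ∀ y ∈ h, killingForm k L x y = 0) : x = 0 := by
  have hcod : Codisjoint (rootSpace h (0 : h → k)) (LieModule.posFittingComp k h a) :=
    (LieModule.isCompl_genWeightSpace_zero_posFittingComp k h a).codisjoint
  apply Subtype.ext
  apply ha x x.2
  intro y hy
  have hy' : (⟨y, hy⟩ : a) ∈ rootSpace h (0 : h → k) ⊔ LieModule.posFittingComp k h a := by
    rw [codisjoint_iff.mp hcod]; trivial
  obtain ⟨y0, hy0, y1, hy1, he⟩ := (LieSubmodule.mem_sup _ _ _).mp hy'
  have hx0 : x ∈ rootSpace h (0 : h → k) := le_zeroRootSubalgebra k a h hx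
  have h1 : killingForm k L x y1 = 0 :=
    LieModule.eq_zero_of_mem_genWeightSpace_mem_posFitting k h a
      (B := (killingForm k L).restrict a.toSubmodule)
      (fun x y z => LieModule.traceForm_apply_lie_apply' k L L x y z) hx0 hy1
  have h0 : killingForm k L x y0 = 0 := by
    apply hxy
    rwa [rootSpace_zero_eq] at hy0
  have : y = (y0 : L) + y1 := by
    exact congrArg Subtype.val he.symm
  rw [this, map_add, h0, h1, add_zero]

lemma abelian_cartan (a : LieSubalgebra k L)
    (ha : ∀ x ∈ a, (∀ y ∈ a, killingForm k L x y = 0) → x = 0)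
    (h : LieSubalgebra k a) [h.IsCartanSubalgebra] : IsLieAbelian h := by
  apply LieModule.isLieAbelian_of_ker_traceForm_eq_bot k h L
  rw [eq_bot_iff]
  intro x hx
  have := nondeg_cartan a ha h x.1 x.2 (fun y hy => LinearMap.congr_fun hx (⟨y, hy⟩ : h))
  exact Subtype.ext this

open Module.End in
lemma semisimple_cartan {n : ℕ} (σ : Fin n → (L ≃ₗ[k] L))
    (hlie : ∀ i (x y : L), σ i ⁅x, y⁆ = ⁅σ i x, σ i y⁆)
    (ha : ∀ x ∈ fixedLieSubalgebra σ hlie,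
      (∀ y ∈ fixedLieSubalgebra σ hlie, killingForm k L x y = 0) → x = 0)
    (h : LieSubalgebra k ↥(fixedLieSubalgebra σ hlie)) [h.IsCartanSubalgebra]
    (x : ↥(fixedLieSubalgebra σ hlie)) (hx : x ∈ h) :
    (ad k L (x : L)).IsSemisimple := by
  have hab := abelian_cartan _ ha h
  have hab' : ∀ u ∈ h, ∀ v ∈ h, ⁅(u : L), (v : L)⁆ = 0 := by
    intro u hu v hv
    have := trivial_lie_zero h h ⟨u, hu⟩ ⟨v, hv⟩
    exact congrArg (fun z : h => ((z : fixedLieSubalgebra σ hlie) : L)) this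
  obtain ⟨N, -, S, hS₁, hN, hS, hSN⟩ := (ad k L (x : L)).exists_isNilpotent_isSemisimple
  have hScomm : ∀ T : Module.End k L, Commute T (ad k L (x : L)) → Commute T S :=
    fun T hT => Algebra.commute_of_mem_adjoin_singleton_of_commute hS₁ hT
  have hS₀ : Commute (ad k L (x : L)) S := hScomm _ (Commute.refl _)
  have hN' := hN
  rw [eq_sub_of_add_eq hSN.symm] at hN
  have aux {μ : k} {y : L} (hy : y ∈ (ad k L (x : L)).maxGenEigenspace μ) : S y = μ • y := by
    rw [maxGenEigenspace_eq] at hy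
    rw [apply_eq_of_mem_of_comm_of_isFinitelySemisimple_of_isNil hy hS₀ hS.isFinitelySemisimple hN]
  have h_der (y z : L) : S ⁅y, z⁆ = ⁅S y, z⁆ + ⁅y, S z⁆ := by
    have hy : y ∈ ⨆ μ : k, (ad k L (x : L)).maxGenEigenspace μ := by
      rw [iSup_maxGenEigenspace_eq_top]; trivial
    have hz : z ∈ ⨆ μ : k, (ad k L (x : L)).maxGenEigenspace μ := by
      rw [iSup_maxGenEigenspace_eq_top]; trivial
    induction hy using Submodule.iSup_induction' with
    | mem α y hy =>
      induction hz using Submodule.iSup_induction' with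
      | mem β z hz =>
        have hyz : ⁅y, z⁆ ∈ (ad k L (x : L)).maxGenEigenspace (α + β) :=
          LieModule.lie_mem_maxGenEigenspace_toEnd hy hz
        rw [aux hy, aux hz, aux hyz, smul_lie, lie_smul, ← add_smul]
      | zero => simp
      | add _ _ _ _ h h' => simp only [lie_add, map_add, h, h']; abel
    | zero => simp
    | add _ _ _ _ h h' => simp only [add_lie, map_add, h, h']; abel
  replace h_der : ∀ y z : L, S ⁅y, z⁆ = ⁅y, S z⁆ - ⁅z, S y⁆ := by
    simp_rw [← lie_skew (S _) _, add_comm, ← sub_eq_add_neg] at h_der; assumption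
  let S' : LieDerivation k L L := ⟨S, h_der⟩
  obtain ⟨y, hy⟩ := LieDerivation.IsKilling.exists_eq_ad S'
  replace hy : S = ad k L y := by rw [← LieDerivation.coe_ad_apply_eq_ad_apply y, hy]
  have hSy : ∀ z, S z = ⁅y, z⁆ := fun z => by rw [hy, ad_apply]
  have hya : y ∈ fixedLieSubalgebra σ hlie := by
    intro i
    have hc : Commute ((σ i : L →ₗ[k] L) : Module.End k L) S := by
      apply hScomm
      ext z
      have hxi : σ i (x : L) = x := x.2 i
      simp [hlie, hxi]
    have hc' : ∀ z, σ i (S z) = S (σ i z) := fun z => LinearMap.congr_fun hc z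
    rw [← sub_eq_zero]
    apply eq_zero_of_lie (k := k)
    intro z
    obtain ⟨w, rfl⟩ := (σ i).surjective z
    rw [sub_lie, ← hlie, ← hSy, ← hSy, hc', sub_self]
  have hyh : ∀ z ∈ h, ⁅(z : L), y⁆ = 0 := by
    intro z hz
    have hc : Commute (ad k L (z : L)) S := by
      apply hScomm
      exact commute_ad k _ _ (hab' z hz x hx)
    apply eq_zero_of_lie (k := k)
    intro w
    have := LinearMap.congr_fun hc w
    simp only [Module.End.mul_apply, ad_apply, hSy] at this
    rw [lie_lie, this, sub_self]
  have hyH : (⟨y, hya⟩ : fixedLieSubalgebra σ hlie) ∈ h := by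
    suffices (⟨y, hya⟩ : fixedLieSubalgebra σ hlie) ∈ h.normalizer by
      rwa [LieSubalgebra.IsCartanSubalgebra.self_normalizing] at this
    rw [LieSubalgebra.mem_normalizer_iff]
    intro z hz
    have : ⁅(⟨y, hya⟩ : fixedLieSubalgebra σ hlie), z⁆ = 0 := by
      apply Subtype.ext
      change ⁅y, (z : L)⁆ = 0
      rw [← lie_skew, hyh z hz, neg_zero]
    rw [this]
    exact h.zero_mem
  have hxy : x - ⟨y, hya⟩ = 0 := by
    apply nondeg_cartan _ ha h _ (h.sub_mem hx hyH)
    intro w hw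
    have hNad : ad k L ((x - ⟨y, hya⟩ : fixedLieSubalgebra σ hlie) : L) = N := by
      change ad k L ((x : L) - y) = N
      rw [map_sub, hSN, ← hy, add_sub_cancel_right]
    have comm : Commute N (ad k L (w : L)) := by
      rw [← hNad]
      exact commute_ad k _ _ (hab' _ (h.sub_mem hx hyH) w hw)
    rw [killingForm_apply_apply, hNad, ← Module.End.mul_eq_comp]
    exact (LinearMap.isNilpotent_trace_of_isNilpotent (comm.isNilpotent_mul_right hN')).eq_zero
  have : (x : L) = y := by
    rw [sub_eq_zero] at hxy
    exact congrArg Subtype.val hxy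
  rw [this, ← hy]
  exact hS

/-- The root spaces span. -/
lemma iSup_rootSpaceOf (H : LieSubalgebra k L)
    (hab : ∀ u ∈ H, ∀ v ∈ H, ⁅(u : L), (v : L)⁆ = 0)
    (hss : ∀ x ∈ H, (ad k L x).IsSemisimple) :
    Submodule.span k {x : L | ∃ α ∈ AddSubgroup.closure
        {α : Module.Dual k H | α ≠ 0 ∧ rootSpaceOf H α ≠ ⊥}, x ∈ rootSpaceOf H α} = ⊤ := by
  have h1 := Module.End.iSup_iInf_maxGenEigenspace_eq_top_of_iSup_maxGenEigenspace_eq_top_of_commute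
    (fun x : H => ad k L (x : L))
    (fun x y _ => by
      exact commute_ad k _ _ (hab x x.2 y y.2))
    (fun x => Module.End.iSup_maxGenEigenspace_eq_top _)
  rw [eq_top_iff, ← h1]
  refine iSup_le fun χ x hx => ?_
  have hx' : ∀ u : H, ⁅(u : L), x⁆ = χ u • x := by
    intro u
    have := (Submodule.mem_iInf _).mp hx u
    rw [(hss u u.2).isFinitelySemisimple.maxGenEigenspace_eq_eigenspace,
      Module.End.mem_eigenspace_iff] at this
    exact this
  by_cases hx0 : x = 0
  · rw [hx0]; exact Submodule.zero_mem _
  let α : Module.Dual k H :=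
    { toFun := χ
      map_add' := fun u v => by
        apply smul_left_injective k hx0
        change χ (u + v) • x = (χ u + χ v) • x
        rw [add_smul, ← hx', ← hx', ← hx']
        exact add_lie _ _ _
      map_smul' := fun c u => by
        apply smul_left_injective k hx0
        change χ (c • u) • x = (c * χ u) • x
        rw [mul_smul, ← hx', ← hx']
        exact smul_lie _ _ _ }
  have hxα : x ∈ rootSpaceOf H α := hx'
  apply Submodule.subset_span
  refine ⟨α, ?_, hxα⟩
  by_cases hα : α = 0
  · rw [hα]; exact AddSubgroup.zero_mem _
  · apply AddSubgroup.subset_closure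
    refine ⟨hα, fun hb => hx0 ?_⟩
    rw [hb] at hxα
    simpa using hxα

end

end TwistAux

/-- let `Q_h` be the root lattice (the subgroup of `h*` generated by the roots
`Δ`), `s = (s₁,…,sₙ) ∈ Hom(Q_h, ℤⁿ)`, and let `τᵢ` act on each root space `g_α` by the scalar
`ζ_{mᵢ}^{-sᵢ(α)}`. Then each `τᵢ` is a Lie algebra automorphism, the tuple `τσ` consists of
commuting automorphisms with `(τσ)^m = id`, and `h` is a Cartan subalgebra of `g^{τσ}` (it is
fixed pointwise and self-centralizing in `g^{τσ}`). -/
theorem twisting_automorphisms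
    (k L : Type*) [Field k] [IsAlgClosed k] [CharZero k]
    [LieRing L] [LieAlgebra k L] [FiniteDimensional k L] [LieAlgebra.IsSimple k L]
    {n : ℕ} (σ : Fin n → (L ≃ₗ[k] L)) (m : Fin n → ℕ) (hm : ∀ i, 0 < m i)
    (ζ : Fin n → k) (hζ : ∀ i, IsPrimitiveRoot (ζ i) (m i))
    (hlie : ∀ i (x y : L), σ i ⁅x, y⁆ = ⁅σ i x, σ i y⁆)
    (hcomm : ∀ i j (x : L), σ i (σ j x) = σ j (σ i x))
    (horder : ∀ i, σ i ^ (m i) = 1)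
    (hne : fixedLieSubalgebra σ hlie ≠ ⊥)
    (h : LieSubalgebra k ↥(fixedLieSubalgebra σ hlie))
    (hcartan : h.IsCartanSubalgebra)
    (s : ↥(AddSubgroup.closure
        {α : Module.Dual k ↥(h.map (fixedLieSubalgebra σ hlie).incl) |
          α ≠ 0 ∧ rootSpaceOf (h.map (fixedLieSubalgebra σ hlie).incl) α ≠ ⊥}) →+
      (Fin n → ℤ))
    (τ : Fin n → (L ≃ₗ[k] L))
    (hτ : ∀ (i : Fin n) (α : Module.Dual k ↥(h.map (fixedLieSubalgebra σ hlie).incl))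
      (hα : α ∈ AddSubgroup.closure
        {α : Module.Dual k ↥(h.map (fixedLieSubalgebra σ hlie).incl) |
          α ≠ 0 ∧ rootSpaceOf (h.map (fixedLieSubalgebra σ hlie).incl) α ≠ ⊥})
      (x : L), x ∈ rootSpaceOf (h.map (fixedLieSubalgebra σ hlie).incl) α →
        τ i x = ζ i ^ (-(s ⟨α, hα⟩ i)) • x) :
    (∀ i (x y : L), τ i ⁅x, y⁆ = ⁅τ i x, τ i y⁆) ∧
    (∀ i j, Commute (τ i * σ i) (τ j * σ j)) ∧
    (∀ i, (τ i * σ i) ^ (m i) = 1) ∧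
    (∀ x ∈ h.map (fixedLieSubalgebra σ hlie).incl, ∀ i, (τ i * σ i) x = x) ∧
    (∀ x : L, (∀ i, (τ i * σ i) x = x) →
      (∀ H : ↥(h.map (fixedLieSubalgebra σ hlie).incl), ⁅(H : L), x⁆ = 0) →
      x ∈ h.map (fixedLieSubalgebra σ hlie).incl) := by
  classical
  have ha := TwistAux.nondeg σ m hm hlie hcomm horder
  have hab0 := TwistAux.abelian_cartan _ ha h
  have hss0 := TwistAux.semisimple_cartan σ hlie ha h
  have hHmem : ∀ u ∈ h.map (fixedLieSubalgebra σ hlie).incl,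
      ∃ v ∈ h, (v : L) = u := by
    intro u hu
    obtain ⟨v, hv, rfl⟩ := (LieSubalgebra.mem_map _ _ _).mp hu
    exact ⟨v, hv, rfl⟩
  have hmemH : ∀ v ∈ h, (v : L) ∈ h.map (fixedLieSubalgebra σ hlie).incl := by
    intro v hv
    exact (LieSubalgebra.mem_map _ _ _).mpr ⟨v, hv, rfl⟩
  have hself : ∀ x : L, x ∈ fixedLieSubalgebra σ hlie →
      (∀ H : ↥(h.map (fixedLieSubalgebra σ hlie).incl), ⁅(H : L), x⁆ = 0) →
      x ∈ h.map (fixedLieSubalgebra σ hlie).incl := by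
    intro x hx hxH
    apply hmemH ⟨x, hx⟩
    suffices (⟨x, hx⟩ : fixedLieSubalgebra σ hlie) ∈ h.normalizer by
      rwa [LieSubalgebra.IsCartanSubalgebra.self_normalizing] at this
    rw [LieSubalgebra.mem_normalizer_iff]
    intro z hz
    have : ⁅(⟨x, hx⟩ : fixedLieSubalgebra σ hlie), z⁆ = 0 := by
      apply Subtype.ext
      change ⁅x, (z : L)⁆ = 0
      rw [← lie_skew, hxH ⟨z, hmemH z hz⟩, neg_zero]
    rw [this]
    exact h.zero_mem
  have hfix : ∀ u ∈ h.map (fixedLieSubalgebra σ hlie).incl, ∀ i, σ i u = u := by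
    intro u hu i
    obtain ⟨v, hv, rfl⟩ := hHmem u hu
    exact v.2 i
  have hab : ∀ u ∈ h.map (fixedLieSubalgebra σ hlie).incl,
      ∀ v ∈ h.map (fixedLieSubalgebra σ hlie).incl, ⁅(u : L), (v : L)⁆ = 0 := by
    intro u hu v hv
    obtain ⟨u, hu', rfl⟩ := hHmem u hu
    obtain ⟨v, hv', rfl⟩ := hHmem v hv
    have := trivial_lie_zero h h ⟨u, hu'⟩ ⟨v, hv'⟩
    exact congrArg (fun z : h => ((z : fixedLieSubalgebra σ hlie) : L)) this
  have hss : ∀ x ∈ h.map (fixedLieSubalgebra σ hlie).incl,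
      (LieAlgebra.ad k L x).IsSemisimple := by
    intro u hu
    obtain ⟨u, hu', rfl⟩ := hHmem u hu
    exact hss0 u hu'
  clear hss0 hab0 ha hHmem hmemH
  generalize h.map (fixedLieSubalgebra σ hlie).incl = H at *
  have hspan := TwistAux.iSup_rootSpaceOf H hab hss
  -- bracket of root spaces
  have hbr : ∀ (α β : Module.Dual k H) (x y : L), x ∈ rootSpaceOf H α → y ∈ rootSpaceOf H β →
      ⁅x, y⁆ ∈ rootSpaceOf H (α + β) := by
    intro α β x y hx hy u
    rw [leibniz_lie, hx u, hy u, smul_lie, lie_smul, ← add_smul, LinearMap.add_apply]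
  have hσ : ∀ i (α : Module.Dual k H) (x : L), x ∈ rootSpaceOf H α → σ i x ∈ rootSpaceOf H α := by
    intro i α x hx u
    rw [← map_smul, ← hx u, hlie, hfix u u.2 i]
  have hζ0 : ∀ i, ζ i ≠ 0 := fun i => (hζ i).ne_zero (hm i).ne'
  have hext : ∀ f g : Module.End k L, (∀ α (_ : α ∈ AddSubgroup.closure
      {α : Module.Dual k H | α ≠ 0 ∧ rootSpaceOf H α ≠ ⊥}), ∀ x ∈ rootSpaceOf H α, f x = g x) →
      f = g := by
    intro f g hfg
    apply LinearMap.ext_on hspan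
    rintro x ⟨α, hα, hx⟩
    exact hfg α hα x hx
  have hzero : ∀ i (x : L), x ∈ rootSpaceOf H 0 → τ i x = x := by
    intro i x hx
    rw [hτ i 0 (AddSubgroup.zero_mem _) x hx]
    have : s ⟨0, AddSubgroup.zero_mem _⟩ = 0 := map_zero s
    rw [this]
    simp
  have hτmem : ∀ i α (_ : α ∈ AddSubgroup.closure
      {α : Module.Dual k H | α ≠ 0 ∧ rootSpaceOf H α ≠ ⊥}) (x : L), x ∈ rootSpaceOf H α →
      τ i x ∈ rootSpaceOf H α := by
    intro i α hα x hx
    rw [hτ i α hα x hx]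
    exact Submodule.smul_mem _ _ hx
  have hτσ : ∀ i j (x : L), τ i (σ j x) = σ j (τ i x) := by
    intro i j x
    have := hext ((τ i : L →ₗ[k] L) * (σ j : L →ₗ[k] L)) ((σ j : L →ₗ[k] L) * (τ i : L →ₗ[k] L)) (by
      intro α hα x hx
      change τ i (σ j x) = σ j (τ i x)
      rw [hτ i α hα x hx, hτ i α hα _ (hσ j α x hx), map_smul])
    exact LinearMap.congr_fun this x
  have hττ : ∀ i j (x : L), τ i (τ j x) = τ j (τ i x) := by
    intro i j x
    have := hext ((τ i : L →ₗ[k] L) * (τ j : L →ₗ[k] L)) ((τ j : L →ₗ[k] L) * (τ i : L →ₗ[k] L)) (by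
      intro α hα x hx
      change τ i (τ j x) = τ j (τ i x)
      rw [hτ i α hα x hx, hτ j α hα x hx, map_smul, map_smul, hτ i α hα x hx, hτ j α hα x hx,
        smul_comm])
    exact LinearMap.congr_fun this x
  have hτpow : ∀ i, τ i ^ m i = 1 := by
    intro i
    have hp : ∀ (t : ℕ) α (hα : α ∈ AddSubgroup.closure
        {α : Module.Dual k H | α ≠ 0 ∧ rootSpaceOf H α ≠ ⊥}) (x : L), x ∈ rootSpaceOf H α →
        (τ i ^ t) x = (ζ i ^ (-(s ⟨α, hα⟩ i))) ^ t • x := by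
      intro t α hα x hx
      induction t with
      | zero => simp
      | succ t ih =>
        rw [pow_succ', LinearEquiv.mul_apply, ih, map_smul, hτ i α hα x hx, smul_smul, pow_succ]
    have := hext ((τ i ^ m i : L ≃ₗ[k] L) : L →ₗ[k] L) 1 (by
      intro α hα x hx
      change (τ i ^ m i) x = x
      rw [hp _ α hα x hx, ← zpow_natCast, zpow_comm, zpow_natCast, (hζ i).pow_eq_one, one_zpow,
        one_smul])
    ext x
    exact LinearMap.congr_fun this x
  refine ⟨?_, ?_, ?_, ?_, ?_⟩
  · intro i x y
    have hx : x ∈ Submodule.span k {x : L | ∃ α ∈ AddSubgroup.closure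
        {α : Module.Dual k H | α ≠ 0 ∧ rootSpaceOf H α ≠ ⊥}, x ∈ rootSpaceOf H α} := by
      rw [hspan]; trivial
    have hy : y ∈ Submodule.span k {x : L | ∃ α ∈ AddSubgroup.closure
        {α : Module.Dual k H | α ≠ 0 ∧ rootSpaceOf H α ≠ ⊥}, x ∈ rootSpaceOf H α} := by
      rw [hspan]; trivial
    induction hx using Submodule.span_induction with
    | mem x hx =>
      obtain ⟨α, hα, hx⟩ := hx
      induction hy using Submodule.span_induction with
      | mem y hy =>
        obtain ⟨β, hβ, hy⟩ := hy
        rw [hτ i α hα x hx, hτ i β hβ y hy,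
          hτ i (α + β) (AddSubgroup.add_mem _ hα hβ) _ (hbr α β x y hx hy)]
        have hs : s ⟨α + β, AddSubgroup.add_mem _ hα hβ⟩ = s ⟨α, hα⟩ + s ⟨β, hβ⟩ :=
          map_add s ⟨α, hα⟩ ⟨β, hβ⟩
        rw [hs, smul_lie, lie_smul, smul_smul, ← zpow_add₀ (hζ0 i), Pi.add_apply, neg_add]
      | zero => simp
      | add _ _ _ _ h1 h2 => simp only [lie_add, map_add, h1, h2]
      | smul c _ _ h1 => simp only [lie_smul, map_smul, h1]
    | zero => simp
    | add _ _ _ _ h1 h2 => simp only [add_lie, map_add, h1, h2]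
    | smul c _ _ h1 => simp only [smul_lie, map_smul, h1]
  · intro i j
    ext x
    change τ i (σ i (τ j (σ j x))) = τ j (σ j (τ i (σ i x)))
    rw [← hτσ j i, ← hτσ i j, hττ, hcomm]
  · intro i
    have : Commute (τ i) (σ i) := by
      ext x
      exact hτσ i i x
    rw [this.mul_pow, hτpow, horder, one_mul]
  · intro x hx i
    change τ i (σ i x) = x
    rw [hfix x hx i]
    apply hzero
    intro u
    rw [hab u u.2 x hx]
    simp
  · intro x hx hxH
    refine hself x (fun i => ?_) hxH
    have h0 : x ∈ rootSpaceOf H 0 := by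
      intro u
      rw [hxH u]
      simp
    have := hx i
    change τ i (σ i x) = x at this
    rwa [hzero i _ (hσ i 0 x h0)] at this
end
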